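/- arXiv:2104.00778 — 13 statements merged into one kernel-verified Lean document; each statement's English description precedes it below -/
import Mathlib

section
/- Let n, k, ℓ be integers with 0 ≤ 2ℓ < k, and suppose 𝓕 is a family of k-element subsets of [n] such that |F ∩ F'| ≠ ℓ for every pair of distinct sets F, F' ∈ 𝓕. If k-ℓ does not divide ℓ!, then |𝓕| ≤ C(n, k-ℓ-1). -/
open Finset in
/-- Double counting of the pairs `S ⊆ T` where `S` is an `i`-subset of `A ∩ B` and `T` is a
`d`-subset of `B`. -/
theorem sum_choose_card_inter_powersetCard {α : Type*} [DecidableEq α] (A B : Finset α)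
    {i d : ℕ} (hid : i ≤ d) :
    ∑ T ∈ B.powersetCard d, (#(A ∩ T)).choose i =
      (#(A ∩ B)).choose i * (#B - i).choose (d - i) := by
  have h1 : ∀ T ∈ B.powersetCard d,
      (#(A ∩ T)).choose i = ∑ S ∈ (A ∩ B).powersetCard i, if S ⊆ T then 1 else 0 := by
    intro T hT
    rw [← card_powersetCard, ← card_filter]
    congr 1
    ext S
    have := (mem_powersetCard.1 hT).1
    simp only [mem_powersetCard, mem_filter, subset_inter_iff]
    exact ⟨fun h => ⟨⟨⟨h.1.1, h.1.2.trans this⟩, h.2⟩, h.1.2⟩,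
      fun h => ⟨⟨h.1.1.1, h.2⟩, h.1.2⟩⟩
  rw [sum_congr rfl h1, sum_comm]
  have h2 : ∀ S ∈ (A ∩ B).powersetCard i,
      (∑ T ∈ B.powersetCard d, if S ⊆ T then 1 else 0) = (#B - i).choose (d - i) := by
    intro S hS
    obtain ⟨hSAB, rfl⟩ := mem_powersetCard.1 hS
    rw [← card_filter]
    exact card_filter_powersetCard_subset _ _ _ (hSAB.trans inter_subset_right) hid
  rw [sum_congr rfl h2, sum_const, card_powersetCard, smul_eq_mul]

open Finset in
/-- A matrix indexed by `k`-subsets of `V` whose entries are a polynomial of degree at most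
`d ≤ k` in the intersection size has rank at most `C(|V|, d)`. -/
theorem rank_intersection_polynomial_le {α : Type*} [DecidableEq α] {V : Finset α}
    {𝓕 : Finset (Finset α)} {k d : ℕ} (hdk : d ≤ k) (h𝓕 : ∀ F ∈ 𝓕, F ⊆ V ∧ #F = k)
    (c : ℕ → ℚ) :
    (Matrix.of fun F F' : 𝓕 =>
      ∑ i ∈ range (d + 1), c i * (#(F.1 ∩ F'.1)).choose i).rank ≤ (#V).choose d := by
  let A : Matrix 𝓕 (V.powersetCard d) ℚ := Matrix.of fun F T =>
    ∑ i ∈ range (d + 1), c i / (k - i).choose (d - i) * (#(F.1 ∩ T.1)).choose i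
  let B : Matrix (V.powersetCard d) 𝓕 ℚ := Matrix.of fun T F => if T.1 ⊆ F.1 then 1 else 0
  have hAB : (Matrix.of fun F F' : 𝓕 =>
      ∑ i ∈ range (d + 1), c i * ((#(F.1 ∩ F'.1)).choose i : ℚ)) = A * B := by
    ext F F'
    obtain ⟨hF'V, hF'k⟩ := h𝓕 F'.1 F'.2
    simp only [A, B, Matrix.mul_apply, Matrix.of_apply, mul_ite, mul_one, mul_zero]
    rw [sum_coe_sort (V.powersetCard d) (fun T => if T ⊆ F'.1 then
      ∑ i ∈ range (d + 1), c i / ((k - i).choose (d - i) : ℚ) * ((#(F.1 ∩ T)).choose i : ℚ)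
      else 0), ← sum_filter]
    have hfilter : (V.powersetCard d).filter (· ⊆ F'.1) = F'.1.powersetCard d := by
      ext T
      simp only [mem_filter, mem_powersetCard]
      exact ⟨fun h => ⟨h.2, h.1.2⟩, fun h => ⟨⟨h.1.trans hF'V, h.2⟩, h.1⟩⟩
    rw [hfilter, sum_comm]
    refine sum_congr rfl fun i hi => ?_
    have hid : i ≤ d := Nat.lt_succ_iff.1 (mem_range.1 hi)
    have hne : ((k - i).choose (d - i) : ℚ) ≠ 0 :=
      Nat.cast_ne_zero.2 (Nat.choose_pos (by omega)).ne'
    rw [← mul_sum, ← Nat.cast_sum, sum_choose_card_inter_powersetCard _ _ hid, hF'k,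
      Nat.cast_mul]
    field_simp
  rw [hAB]
  exact (Matrix.rank_mul_le_left A B).trans (A.rank_le_card_width.trans_eq (by simp))

/-- An integer matrix congruent to the identity modulo a prime has full rank over `ℚ`. -/
theorem rank_eq_card_of_map_zmod_eq_one {m : Type*} [Fintype m] [DecidableEq m] {p : ℕ}
    (hp : p.Prime) (M : Matrix m m ℤ) (hM : M.map (Int.castRingHom (ZMod p)) = 1) :
    (M.map (Int.castRingHom ℚ)).rank = Fintype.card m := by
  have : Fact p.Prime := ⟨hp⟩
  apply Matrix.rank_of_isUnit
  rw [Matrix.isUnit_iff_isUnit_det, isUnit_iff_ne_zero]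
  have hdet : M.det ≠ 0 := by
    intro h
    have h' := RingHom.map_det (Int.castRingHom (ZMod p)) M
    rw [h, map_zero, RingHom.mapMatrix_apply, hM, Matrix.det_one] at h'
    exact zero_ne_one h'
  have h' := RingHom.map_det (Int.castRingHom ℚ) M
  rw [RingHom.mapMatrix_apply] at h'
  rw [← h']
  simpa using hdet

/-- If a power of the prime `p` divides `d + 1` but not `y`, then `p ∣ C(y + d, d)`. -/
theorem prime_dvd_choose_add_of_pow_dvd {p a d y : ℕ} (hp : p.Prime) (hd : p ^ a ∣ d + 1)
    (hy : ¬ p ^ a ∣ y) : p ∣ (y + d).choose d := by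
  by_contra h
  have hmul := Nat.choose_succ_right_eq (y + d) d
  rw [Nat.add_sub_cancel] at hmul
  have hco : Nat.Coprime (p ^ a) ((y + d).choose d) :=
    Nat.Coprime.pow_left a ((Nat.Prime.coprime_iff_not_dvd hp).2 h)
  exact hy (hco.dvd_of_dvd_mul_left (hmul ▸ hd.mul_left _))

/-- If `k - ℓ` does not divide `ℓ!`, then for some prime `p` the binomial coefficient
`C(x - ℓ - 1, k - ℓ - 1)` is divisible by `p` for all natural numbers `x < k` with `x ≠ ℓ`. -/
theorem exists_prime_dvd_ring_choose {k ℓ : ℕ} (hk : ℓ < k)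
    (hdvd : ¬ (k - ℓ) ∣ Nat.factorial ℓ) :
    ∃ p : ℕ, p.Prime ∧ ∀ x : ℕ, x < k → x ≠ ℓ →
      (p : ℤ) ∣ Ring.choose ((x : ℤ) + -((ℓ : ℤ) + 1)) (k - ℓ - 1) := by
  rw [Nat.dvd_iff_prime_pow_dvd_dvd] at hdvd
  push Not at hdvd
  obtain ⟨p, a, hp, hpk, hpl⟩ := hdvd
  refine ⟨p, hp, fun x hxk hxl => ?_⟩
  obtain ⟨d, rfl⟩ : ∃ d, k = ℓ + d + 1 := ⟨k - ℓ - 1, by omega⟩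
  rw [show ℓ + d + 1 - ℓ - 1 = d by omega]
  rw [show ℓ + d + 1 - ℓ = d + 1 by omega] at hpk
  rcases lt_or_gt_of_ne hxl with h | h
  · obtain ⟨y, rfl⟩ : ∃ y, ℓ = x + y := ⟨ℓ - x, by omega⟩
    have hy : ¬ p ^ a ∣ y := fun hy =>
      hpl (hy.trans (Nat.dvd_factorial (by omega) (by omega)))
    rw [show (x : ℤ) + -(((x + y : ℕ) : ℤ) + 1) = -((y : ℤ) + 1) by push_cast; ring,
      Ring.choose_neg, show (y : ℤ) + 1 + d - 1 = ((y + d : ℕ) : ℤ) by push_cast; ring,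
      Ring.choose_natCast, Units.smul_def, smul_eq_mul]
    exact (Int.natCast_dvd_natCast.2 (prime_dvd_choose_add_of_pow_dvd hp hpk hy)).mul_left _
  · obtain ⟨z, rfl⟩ : ∃ z, x = ℓ + 1 + z := ⟨x - ℓ - 1, by omega⟩
    rw [show ((ℓ + 1 + z : ℕ) : ℤ) + -((ℓ : ℤ) + 1) = (z : ℤ) by push_cast; ring,
      Ring.choose_natCast, Nat.choose_eq_zero_of_lt (by omega)]
    simp


/-- If `𝓕` is a family of `k`-subsets of `[n]` with `2ℓ < k` such that `|F ∩ F'| ≠ ℓ` for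
all distinct `F, F' ∈ 𝓕`, and `k - ℓ` does not divide `ℓ!`, then `|𝓕| ≤ C(n, k-ℓ-1)`. -/
theorem stmt_5 (n k ℓ : ℕ) (hk : 2 * ℓ < k)
    (𝓕 : Finset (Finset ℕ))
    (hunif : ∀ F ∈ 𝓕, F ⊆ Finset.Icc 1 n ∧ F.card = k)
    (hmiss : ∀ F ∈ 𝓕, ∀ F' ∈ 𝓕, F ≠ F' → (F ∩ F').card ≠ ℓ)
    (hdvd : ¬ (k - ℓ) ∣ Nat.factorial ℓ) :
    𝓕.card ≤ n.choose (k - ℓ - 1) := by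
  classical
  obtain ⟨p, hp, hpdvd⟩ := exists_prime_dvd_ring_choose (by omega : ℓ < k) hdvd
  set d := k - ℓ - 1
  let M : Matrix 𝓕 𝓕 ℤ := Matrix.of fun F F' =>
    Ring.choose (((F.1 ∩ F'.1).card : ℤ) + -((ℓ : ℤ) + 1)) d
  have hmod : M.map (Int.castRingHom (ZMod p)) = 1 := by
    ext F F'
    simp only [M, Matrix.map_apply, Matrix.of_apply, Matrix.one_apply, eq_intCast]
    split_ifs with h
    · subst h
      rw [Finset.inter_self, (hunif F.1 F.2).2,
        show (k : ℤ) + -((ℓ : ℤ) + 1) = (d : ℤ) by omega, Ring.choose_natCast]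
      simp
    · rw [ZMod.intCast_zmod_eq_zero_iff_dvd]
      have hne : F.1 ≠ F'.1 := fun e => h (Subtype.ext e)
      refine hpdvd _ ?_ (hmiss F.1 F.2 F'.1 F'.2 hne)
      obtain ⟨-, hF⟩ := hunif F.1 F.2
      obtain ⟨-, hF'⟩ := hunif F'.1 F'.2
      refine lt_of_le_of_ne (hF ▸ Finset.card_le_card Finset.inter_subset_left) fun e => hne ?_
      have h1 := Finset.eq_of_subset_of_card_le (Finset.inter_subset_left (s₁ := F.1) (s₂ := F'.1))
        (by omega)
      exact Finset.eq_of_subset_of_card_le (Finset.inter_eq_left.1 h1) (by omega)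
  have hrank := rank_eq_card_of_map_zmod_eq_one hp M hmod
  have hM : M.map (Int.castRingHom ℚ) = Matrix.of fun F F' : 𝓕 =>
      ∑ i ∈ Finset.range (d + 1),
        ((Ring.choose (-((ℓ : ℤ) + 1)) (d - i) : ℤ) : ℚ) * ((F.1 ∩ F'.1).card.choose i : ℚ) := by
    ext F F'
    simp only [M, Matrix.map_apply, Matrix.of_apply, eq_intCast]
    rw [Ring.add_choose_eq d (Commute.all _ _),
      Finset.Nat.sum_antidiagonal_eq_sum_range_succ_mk, Int.cast_sum]
    refine Finset.sum_congr rfl fun i _ => ?_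
    rw [Ring.choose_natCast, Int.cast_mul, Int.cast_natCast, mul_comm]
  have hle := rank_intersection_polynomial_le (d := d) (by omega) hunif
    fun i => ((Ring.choose (-((ℓ : ℤ) + 1)) (d - i) : ℤ) : ℚ)
  rw [← hM, hrank] at hle
  simpa using hle
end

section
/- Let n, k, ℓ be integers with k ≥ 3 and 0 ≤ 2ℓ < k, and suppose 𝓕 is a family of k-element subsets of [n] such that |F ∩ F'| ≠ ℓ for every pair of distinct sets F, F' ∈ 𝓕. If ℓ < (log k)/(log log k), where log denotes the natural logarithm, then |𝓕| ≤ C(n, k-ℓ-1). -/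
theorem card_powersetCard_filter_between {α : Type*} [DecidableEq α] {T F X : Finset α}
    (hTF : T ⊆ F) (hFX : F ⊆ X) {d : ℕ} (hd : T.card ≤ d) :
    ((X.powersetCard d).filter (fun S => T ⊆ S ∧ S ⊆ F)).card
      = (F.card - T.card).choose (d - T.card) := by
  rw [← Finset.card_sdiff_of_subset hTF, ← Finset.card_powersetCard]
  refine Finset.card_nbij' (fun S => S \ T) (fun S => S ∪ T) ?_ ?_ ?_ ?_
  · intro S hS
    simp only [Finset.coe_filter, Finset.mem_powersetCard, Set.mem_ofPred_eq] at hS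
    obtain ⟨⟨-, hSd⟩, hTS, hSF⟩ := hS
    simp only [Finset.mem_coe, Finset.mem_powersetCard]
    exact ⟨Finset.sdiff_subset_sdiff hSF le_rfl, by rw [Finset.card_sdiff_of_subset hTS, hSd]⟩
  · intro S hS
    simp only [Finset.mem_coe, Finset.mem_powersetCard] at hS
    obtain ⟨hSF, hSd⟩ := hS
    have hdisj : Disjoint S T := Finset.disjoint_of_subset_left hSF Finset.sdiff_disjoint
    have hSTF : S ∪ T ⊆ F := Finset.union_subset (hSF.trans Finset.sdiff_subset) hTF
    simp only [Finset.coe_filter, Finset.mem_powersetCard, Set.mem_ofPred_eq]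
    refine ⟨⟨hSTF.trans hFX, ?_⟩, Finset.subset_union_right, hSTF⟩
    rw [Finset.card_union_of_disjoint hdisj, hSd]
    omega
  · intro S hS
    simp only [Finset.coe_filter, Set.mem_ofPred_eq] at hS
    exact Finset.sdiff_union_of_subset hS.2.1
  · intro S hS
    simp only [Finset.mem_coe, Finset.mem_powersetCard] at hS
    have hdisj : Disjoint S T := Finset.disjoint_of_subset_left hS.1 Finset.sdiff_disjoint
    exact Finset.union_sdiff_cancel_right hdisj

/-- A signed weighting of a `k`-uniform family whose degree vanishes at every `d`-set has vanishing
degree at every set of size at most `d`. -/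
theorem sum_filter_superset_eq_zero {α : Type*} [DecidableEq α] {X : Finset α}
    {𝓕 : Finset (Finset α)} {k d : ℕ} (hdk : d ≤ k) (h𝓕 : ∀ F ∈ 𝓕, F ⊆ X ∧ F.card = k)
    (a : Finset α → ℤ)
    (ha : ∀ S ∈ X.powersetCard d, ∑ F ∈ 𝓕 with S ⊆ F, a F = 0)
    {T : Finset α} (hT : T.card ≤ d) : ∑ F ∈ 𝓕 with T ⊆ F, a F = 0 := by
  have hcount : ∑ S ∈ X.powersetCard d with T ⊆ S, ∑ F ∈ 𝓕 with S ⊆ F, a F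
      = ((k - T.card).choose (d - T.card) : ℤ) * ∑ F ∈ 𝓕 with T ⊆ F, a F := by
    simp only [Finset.sum_filter (s := 𝓕)]
    rw [Finset.sum_comm, Finset.mul_sum]
    refine Finset.sum_congr rfl fun F hF => ?_
    rw [← Finset.sum_filter, Finset.filter_filter, Finset.sum_const, nsmul_eq_mul]
    by_cases hTF : T ⊆ F
    · rw [card_powersetCard_filter_between hTF (h𝓕 F hF).1 hT, (h𝓕 F hF).2, if_pos hTF]
    · rw [if_neg hTF, Finset.filter_false_of_mem fun S _ h => hTF (h.1.trans h.2)]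
      simp
  rw [Finset.sum_eq_zero fun S hS => ha S (Finset.mem_filter.1 hS).1] at hcount
  have hpos : 0 < (k - T.card).choose (d - T.card) := Nat.choose_pos (by omega)
  rcases mul_eq_zero.1 hcount.symm with h | h
  · exact absurd h (by exact_mod_cast hpos.ne')
  · exact h

theorem sum_mul_choose_card_inter_eq_zero {α : Type*} [DecidableEq α] {X : Finset α}
    {𝓕 : Finset (Finset α)} {k d : ℕ} (hdk : d ≤ k) (h𝓕 : ∀ F ∈ 𝓕, F ⊆ X ∧ F.card = k)
    (a : Finset α → ℤ)
    (ha : ∀ S ∈ X.powersetCard d, ∑ F ∈ 𝓕 with S ⊆ F, a F = 0)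
    (G : Finset α) {j : ℕ} (hj : j ≤ d) :
    ∑ F ∈ 𝓕, ((G ∩ F).card.choose j : ℤ) * a F = 0 := by
  have key : ∀ F ∈ 𝓕, ((G ∩ F).card.choose j : ℤ) * a F
      = ∑ T ∈ G.powersetCard j, if T ⊆ F then a F else 0 := by
    intro F _
    rw [← Finset.sum_filter, Finset.sum_const, nsmul_eq_mul, ← Finset.card_powersetCard]
    congr 3
    ext T
    simp only [Finset.mem_powersetCard, Finset.mem_filter, Finset.subset_inter_iff]
    tauto
  rw [Finset.sum_congr rfl key, Finset.sum_comm]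
  refine Finset.sum_eq_zero fun T hT => ?_
  rw [← Finset.sum_filter]
  exact sum_filter_superset_eq_zero hdk h𝓕 a ha ((Finset.mem_powersetCard.1 hT).2.trans_le hj)

/-- The **Frankl–Wilson** rank bound for a `k`-uniform family and an integer-valued polynomial of
degree at most `d`, written in the binomial basis. -/
theorem card_le_choose_of_intersection_polynomial {α : Type*} [DecidableEq α] {X : Finset α}
    {𝓕 : Finset (Finset α)} {k d : ℕ} (hdk : d ≤ k) (h𝓕 : ∀ F ∈ 𝓕, F ⊆ X ∧ F.card = k)
    {p : ℕ} (hp : p.Prime) (f : ℕ → ℤ) (c : ℕ → ℤ)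
    (hf : ∀ m, f m = ∑ j ∈ Finset.range (d + 1), c j * (m.choose j : ℤ))
    (hfk : f k = 1)
    (hdvd : ∀ F ∈ 𝓕, ∀ F' ∈ 𝓕, F ≠ F' → (p : ℤ) ∣ f (F ∩ F').card) :
    𝓕.card ≤ X.card.choose d := by
  have : Fact p.Prime := ⟨hp⟩
  let M : Matrix 𝓕 𝓕 ℤ := Matrix.of fun F G => f (F.1 ∩ G.1).card
  have hM : M.map (Int.castRingHom (ZMod p)) = 1 := by
    ext F G
    by_cases h : F = G
    · subst h
      simp [M, (h𝓕 F.1 F.2).2, hfk]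
    · have := hdvd F.1 F.2 G.1 G.2 (fun h' => h (Subtype.ext h'))
      simpa [M, Matrix.one_apply_ne h] using (ZMod.intCast_zmod_eq_zero_iff_dvd _ p).2 this
  have hdet : M.det ≠ 0 := by
    intro h0
    have h1 := RingHom.map_det (Int.castRingHom (ZMod p)) M
    rw [RingHom.mapMatrix_apply, hM, Matrix.det_one, h0, map_zero] at h1
    exact zero_ne_one h1
  let v : 𝓕 → (X.powersetCard d → ℤ) := fun F S => if S.1 ⊆ F.1 then 1 else 0
  have hv : LinearIndependent ℤ v := by
    rw [Fintype.linearIndependent_iff]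
    intro b hb
    let a : Finset α → ℤ := fun F => if h : F ∈ 𝓕 then b ⟨F, h⟩ else 0
    have hab : ∀ F : 𝓕, a F.1 = b F := fun F => by simp [a]
    have ha : ∀ S ∈ X.powersetCard d, ∑ F ∈ 𝓕 with S ⊆ F, a F = 0 := by
      intro S hS
      have h := congrFun hb ⟨S, hS⟩
      rw [Finset.sum_filter, ← Finset.sum_coe_sort]
      simpa [v, hab] using h
    have hker : M.mulVec b = 0 := by
      ext G
      have : ∑ F ∈ 𝓕, f (G.1 ∩ F).card * a F = 0 := by
        simp only [hf, Finset.sum_mul]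
        rw [Finset.sum_comm]
        refine Finset.sum_eq_zero fun j hj => ?_
        simp only [mul_assoc]
        rw [← Finset.mul_sum, sum_mul_choose_card_inter_eq_zero hdk h𝓕 a ha G.1
          (Nat.lt_succ_iff.1 (Finset.mem_range.1 hj)), mul_zero]
      rw [← Finset.sum_coe_sort] at this
      simpa [Matrix.mulVec, dotProduct, M, hab] using this
    have hb0 : b = 0 := by
      by_contra hne
      exact hdet (Matrix.exists_mulVec_eq_zero_iff.1 ⟨b, hne, hker⟩)
    exact fun i => congrFun hb0 i
  simpa using hv.fintype_card_le_finrank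

/-- The polynomial `C(x - ℓ - 1, d)` in the binomial basis. -/
theorem ringChoose_sub_eq_sum (ℓ d m : ℕ) :
    Ring.choose ((m : ℤ) - ℓ - 1) d
      = ∑ j ∈ Finset.range (d + 1), Ring.choose (-(ℓ : ℤ) - 1) (d - j) * (m.choose j : ℤ) := by
  rw [show (m : ℤ) - ℓ - 1 = m + (-(ℓ : ℤ) - 1) by ring, Ring.add_choose_eq d (Commute.all _ _),
    Finset.Nat.sum_antidiagonal_eq_sum_range_succ
      (fun i j => Ring.choose (m : ℤ) i * Ring.choose (-(ℓ : ℤ) - 1) j)]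
  simp only [Ring.choose_natCast, mul_comm, Nat.succ_eq_add_one]

theorem prime_dvd_choose_of_prime_pow_dvd {p a m j : ℕ} (hp : p.Prime) (hm : p ^ a ∣ m)
    (hm0 : 0 < m) (hj0 : 0 < j) (hj : j < p ^ a) : p ∣ (m - 1 + j).choose j := by
  obtain ⟨i, rfl⟩ : ∃ i, j = i + 1 := ⟨j - 1, by omega⟩
  have hrec : (m - 1 + (i + 1)).choose (i + 1) * (i + 1) = (m - 1 + (i + 1)).choose i * m := by
    rw [Nat.choose_succ_right_eq]
    congr 1
    omega
  by_contra hnot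
  have hcop : Nat.Coprime (p ^ a) ((m - 1 + (i + 1)).choose (i + 1)) :=
    Nat.Coprime.pow_left a ((Nat.Prime.coprime_iff_not_dvd hp).2 hnot)
  have hdvd : p ^ a ∣ (m - 1 + (i + 1)).choose (i + 1) * (i + 1) :=
    hrec ▸ Dvd.dvd.mul_left hm _
  exact absurd (Nat.le_of_dvd hj0 (hcop.dvd_of_dvd_mul_left hdvd)) (by omega)

/-- A `k`-uniform family avoiding intersection size `ℓ` has at most `C(n, k-ℓ-1)` members as soon
as `k - ℓ` is divisible by a prime power exceeding `ℓ`. -/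
theorem card_le_choose_of_prime_pow_dvd {α : Type*} [DecidableEq α] {X : Finset α}
    {𝓕 : Finset (Finset α)} {k ℓ : ℕ} (hℓk : ℓ < k)
    (h𝓕 : ∀ F ∈ 𝓕, F ⊆ X ∧ F.card = k)
    (hmiss : ∀ F ∈ 𝓕, ∀ F' ∈ 𝓕, F ≠ F' → (F ∩ F').card ≠ ℓ)
    {p a : ℕ} (hp : p.Prime) (hdvd : p ^ a ∣ k - ℓ) (hlt : ℓ < p ^ a) :
    𝓕.card ≤ X.card.choose (k - ℓ - 1) := by
  refine card_le_choose_of_intersection_polynomial (by omega) h𝓕 hp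
    (fun m => Ring.choose ((m : ℤ) - ℓ - 1) (k - ℓ - 1)) _
    (ringChoose_sub_eq_sum ℓ (k - ℓ - 1)) ?_ ?_
  · rw [show (k : ℤ) - ℓ - 1 = ((k - ℓ - 1 : ℕ) : ℤ) by omega, Ring.choose_natCast,
      Nat.choose_self, Nat.cast_one]
  · intro F hF F' hF' hne
    have hcard : (F ∩ F').card < k := by
      refine lt_of_le_of_ne ((h𝓕 F hF).2 ▸ Finset.card_le_card Finset.inter_subset_left) ?_
      intro h
      have h1 := Finset.eq_of_subset_of_card_le (Finset.inter_subset_left : F ∩ F' ⊆ F)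
        (by rw [(h𝓕 F hF).2, h])
      have h2 := Finset.eq_of_subset_of_card_le (Finset.inter_subset_right : F ∩ F' ⊆ F')
        (by rw [(h𝓕 F' hF').2, h])
      exact hne (h1.symm.trans h2)
    have hmissF := hmiss F hF F' hF' hne
    generalize (F ∩ F').card = m at hcard hmissF
    rcases lt_or_gt_of_ne hmissF with hm | hm
    · rw [show (m : ℤ) - ℓ - 1 = -((ℓ - m + 1 : ℕ) : ℤ) by omega, Ring.choose_neg,
        show ((ℓ - m + 1 : ℕ) : ℤ) + ((k - ℓ - 1 : ℕ) : ℤ) - 1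
          = ((k - ℓ - 1 + (ℓ - m) : ℕ) : ℤ) by omega, Ring.choose_natCast, Units.smul_def,
        smul_eq_mul, Nat.choose_symm_add]
      exact Dvd.dvd.mul_left (Int.natCast_dvd_natCast.2
        (prime_dvd_choose_of_prime_pow_dvd hp hdvd (by omega) (by omega) (by omega))) _
    · rw [show (m : ℤ) - ℓ - 1 = ((m - ℓ - 1 : ℕ) : ℤ) by omega, Ring.choose_natCast,
        Nat.choose_eq_zero_of_lt (by omega)]
      simp

theorem exists_prime_pow_dvd_of_factorial_lt {m ℓ : ℕ} (h : Nat.factorial ℓ < m) :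
    ∃ p a : ℕ, p.Prime ∧ p ^ a ∣ m ∧ ℓ < p ^ a := by
  by_contra! hno
  have : m ∣ Nat.factorial ℓ := (Nat.dvd_iff_prime_pow_dvd_dvd _ _).2 fun p a hp hpa =>
    Nat.dvd_factorial (Nat.pow_pos hp.pos) (hno p a hp hpa)
  exact absurd (Nat.le_of_dvd (Nat.factorial_pos ℓ) this) (by omega)

theorem add_factorial_le_pow_self {ℓ : ℕ} (h : 2 ≤ ℓ) : ℓ + Nat.factorial ℓ ≤ ℓ ^ ℓ := by
  induction ℓ, h using Nat.le_induction with
  | base => decide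
  | succ n hn ih =>
    have h1 : n ^ n ≤ (n + 1) ^ n := Nat.pow_le_pow_left (by omega) n
    calc n + 1 + Nat.factorial (n + 1) = (n + 1) * (1 + Nat.factorial n) := by
          rw [Nat.factorial_succ]; ring
      _ ≤ (n + 1) * (n + 1) ^ n := Nat.mul_le_mul_left _ (by omega)
      _ = (n + 1) ^ (n + 1) := by rw [pow_succ]; ring

theorem le_three_mul_log {x : ℝ} (h1 : 1.9 ≤ x) (h2 : x ≤ 2.72) : x ≤ 3 * Real.log x := by
  have hx : 0 < x := by linarith
  have hlog : Real.log x = Real.log 2 + Real.log (x / 2) := by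
    rw [← Real.log_mul (by norm_num) (by positivity)]
    congr 1
    ring
  have h3 : 1 - (x / 2)⁻¹ ≤ Real.log (x / 2) := Real.one_sub_inv_le_log_of_pos (by positivity)
  have h4 : 0.693 < Real.log 2 := lt_trans (by norm_num) Real.log_two_gt_d9
  have h5 : x ≤ 3 * (0.693 + (1 - (x / 2)⁻¹)) := by
    rw [inv_div, ← sub_nonneg]
    have : 3 * (0.693 + (1 - 2 / x)) - x = (5.079 * x - 6 - x ^ 2) / x := by
      field_simp
      ring
    rw [this]
    apply div_nonneg _ hx.le
    nlinarith
  linarith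

theorem nineteen_tenths_le_log_seven : 1.9 ≤ Real.log 7 := by
  rw [Real.le_log_iff_exp_le (by norm_num)]
  have h1 : Real.exp 1.9 ^ 10 = Real.exp 1 ^ 19 := by
    rw [← Real.exp_nat_mul, ← Real.exp_nat_mul]
    norm_num
  have h2 : Real.exp 1 ^ 19 ≤ 2.7182818286 ^ 19 :=
    pow_le_pow_left₀ (Real.exp_pos _).le Real.exp_one_lt_d9.le 19
  refine le_of_pow_le_pow_left₀ (n := 10) (by norm_num) (by norm_num) ?_
  rw [h1]
  exact h2.trans (by norm_num)

theorem add_factorial_lt_of_lt_log_div_log_log {k ℓ : ℕ} (hk3 : 3 ≤ k) (hk : 2 * ℓ < k)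
    (hℓ : (ℓ : ℝ) < Real.log k / Real.log (Real.log k)) : ℓ + Nat.factorial ℓ < k := by
  by_contra! hle
  have hℓ3 : 3 ≤ ℓ := by
    by_contra! h
    interval_cases ℓ <;> simp [Nat.factorial] at hle <;> omega
  have hk7 : (7 : ℝ) ≤ k := by exact_mod_cast (by omega : 7 ≤ k)
  have hL : 1.9 ≤ Real.log k :=
    nineteen_tenths_le_log_seven.trans (Real.log_le_log (by norm_num) hk7)
  have hL0 : 0 < Real.log k := by linarith
  have hLL : 0 < Real.log (Real.log k) := Real.log_pos (by linarith)
  have hℓ0 : (3 : ℝ) ≤ ℓ := by exact_mod_cast hℓ3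
  rw [lt_div_iff₀ hLL] at hℓ
  have hpow : Real.log k ≤ ℓ * Real.log ℓ := by
    rw [← Real.log_pow]
    exact Real.log_le_log (by linarith)
      (by exact_mod_cast hle.trans (add_factorial_le_pow_self (by omega)))
  have hLℓ : Real.log k < ℓ := by
    refine (Real.log_lt_log_iff hL0 (by linarith)).1 ?_
    exact lt_of_mul_lt_mul_left (hℓ.trans_le hpow) (by linarith)
  have hlt1 : Real.log (Real.log k) < 1 := by
    by_contra! h
    nlinarith
  have hLe : Real.log k ≤ 2.72 := by
    have := (Real.log_lt_iff_lt_exp hL0).1 hlt1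
    linarith [Real.exp_one_lt_d9]
  have := le_three_mul_log hL hLe
  nlinarith

/-- If `𝓕` is a family of `k`-subsets of `[n]` with `k ≥ 3`, `2ℓ < k`, such that
`|F ∩ F'| ≠ ℓ` for all distinct `F, F' ∈ 𝓕`, and `ℓ < log k / log log k`, then
`|𝓕| ≤ C(n, k-ℓ-1)`. -/
theorem stmt_6 (n k ℓ : ℕ) (hk3 : 3 ≤ k) (hk : 2 * ℓ < k)
    (𝓕 : Finset (Finset ℕ))
    (hunif : ∀ F ∈ 𝓕, F ⊆ Finset.Icc 1 n ∧ F.card = k)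
    (hmiss : ∀ F ∈ 𝓕, ∀ F' ∈ 𝓕, F ≠ F' → (F ∩ F').card ≠ ℓ)
    (hℓ : (ℓ : ℝ) < Real.log k / Real.log (Real.log k)) :
    𝓕.card ≤ n.choose (k - ℓ - 1) := by
  have hlt := add_factorial_lt_of_lt_log_div_log_log hk3 hk hℓ
  obtain ⟨p, a, hp, hdvd, hpa⟩ :=
    exists_prime_pow_dvd_of_factorial_lt (show Nat.factorial ℓ < k - ℓ by omega)
  simpa using card_le_choose_of_prime_pow_dvd (by omega) hunif hmiss hp hdvd hpa
end

section
/- Let s and t be positive integers with t > 2^{2s} - 2s - 1, and let n ≥ 3s + t. Then there exists a K_{s,t}-intersecting family 𝓕 of labelled graphs on n vertices with |𝓕| > 2^{C(n,2) - st}. -/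
/-- Sets of pairs whose second coordinates all agree. -/
def starSets (s m : ℕ) : Finset (Finset (Fin s × Fin m)) :=
  insert ∅ ((Finset.univ ×ˢ (Finset.univ.erase ∅ : Finset (Finset (Fin s)))).image
    fun p : Fin m × Finset (Fin s) => p.2 ×ˢ {p.1})

theorem card_starSets (s m : ℕ) : (starSets s m).card = m * (2 ^ s - 1) + 1 := by
  unfold starSets
  rw [Finset.card_insert_of_notMem, Finset.card_image_of_injOn]
  · simp [Finset.card_product, Finset.card_erase_of_mem]
  · rintro ⟨j, A⟩ hA ⟨k, B⟩ hB h
    simp only [Finset.coe_product, Set.mem_prod, Finset.mem_coe, Finset.mem_erase,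
      Finset.mem_univ, and_true, true_and] at hA hB h
    have key : ∀ i l, (i ∈ A ∧ j = l) ↔ (i ∈ B ∧ k = l) := fun i l => by
      simpa using Finset.ext_iff.mp h (i, l)
    obtain ⟨i, hi⟩ := Finset.nonempty_iff_ne_empty.mpr hA
    obtain rfl : j = k := ((key i j).mp ⟨hi, rfl⟩).2.symm
    have : A = B := Finset.ext fun i => by simpa using key i j
    rw [this]
  · simp only [Finset.mem_image, Finset.mem_product, Finset.mem_univ, Finset.mem_erase,
      true_and, and_true, Prod.exists, not_exists, not_and]
    intro j A hA h
    simp at h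
    exact hA h

theorem exists_of_mem_starSets {s m : ℕ} (hm : 0 < m) {Q : Finset (Fin s × Fin m)}
    (hQ : Q ∈ starSets s m) : ∃ j, ∀ p ∈ Q, p.2 = j := by
  simp only [starSets, Finset.mem_insert, Finset.mem_image, Prod.exists] at hQ
  obtain rfl | ⟨j, A, -, rfl⟩ := hQ
  · exact ⟨⟨0, hm⟩, by simp⟩
  · exact ⟨j, fun p hp => by simpa using (Finset.mem_product.mp hp).2⟩

/-- Graphs in which all vertices of `Fin m`, except at most one, are joined to all of `Fin s`. -/
def AlmostJoined {V : Type*} {s m : ℕ} (φ : Fin s ⊕ Fin m ↪ V) (G : SimpleGraph V) : Prop :=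
  ∃ j, ∀ i, ∀ k ≠ j, G.Adj (φ (.inl i)) (φ (.inr k))

theorem AlmostJoined.exists_copy {V : Type*} {s t : ℕ} {φ : Fin s ⊕ Fin (t + 2) ↪ V}
    {G₁ G₂ : SimpleGraph V} (h₁ : AlmostJoined φ G₁) (h₂ : AlmostJoined φ G₂) :
    ∃ f : Fin s ⊕ Fin t → V, Function.Injective f ∧
      ∀ a b, (completeBipartiteGraph (Fin s) (Fin t)).Adj a b → (G₁ ⊓ G₂).Adj (f a) (f b) := by
  obtain ⟨j₁, h₁⟩ := h₁
  obtain ⟨j₂, h₂⟩ := h₂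
  have hcard : Fintype.card (Fin t) ≤
      Fintype.card {k // k ∈ (Finset.univ \ {j₁, j₂} : Finset (Fin (t + 2)))} := by
    rw [Fintype.card_coe, Fintype.card_fin]
    have := Finset.le_card_sdiff {j₁, j₂} (Finset.univ : Finset (Fin (t + 2)))
    have := Finset.card_le_two (a := j₁) (b := j₂)
    rw [Finset.card_univ, Fintype.card_fin] at *
    omega
  obtain ⟨g⟩ := Function.Embedding.nonempty_of_card_le hcard
  have hg : ∀ k, (g k : Fin (t + 2)) ≠ j₁ ∧ (g k : Fin (t + 2)) ≠ j₂ := fun k => by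
    have h := (Finset.mem_sdiff.mp (g k).2).2
    rwa [Finset.mem_insert, Finset.mem_singleton, not_or] at h
  have hadj : ∀ i k, (G₁ ⊓ G₂).Adj (φ (.inl i)) (φ (.inr (g k))) := fun i k =>
    ⟨h₁ i _ (hg k).1, h₂ i _ (hg k).2⟩
  refine ⟨φ ∘ Sum.map id fun k => (g k : Fin (t + 2)),
    φ.injective.comp (Sum.map_injective.mpr
      ⟨Function.injective_id, Subtype.val_injective.comp g.injective⟩), ?_⟩
  rintro (a | a) (b | b) hab
  · simp at hab
  · exact hadj a b
  · exact (hadj b a).symm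
  · simp at hab

open Classical in
theorem exists_almostJoined_family {V : Type*} [Fintype V] {s m : ℕ} (hm : 0 < m)
    (φ : Fin s ⊕ Fin m ↪ V) :
    s * m ≤ (Fintype.card V).choose 2 ∧
    ∃ 𝓕 : Finset (SimpleGraph V), (∀ G ∈ 𝓕, AlmostJoined φ G) ∧
      (m * (2 ^ s - 1) + 1) * 2 ^ ((Fintype.card V).choose 2 - s * m) ≤ 𝓕.card := by
  let P : Fin s × Fin m → Sym2 V := fun p => s(φ (.inl p.1), φ (.inr p.2))
  have hP : Function.Injective P := by
    rintro ⟨i, j⟩ ⟨k, l⟩ h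
    simpa [P] using h
  let E : Finset (Sym2 V) := (⊤ : SimpleGraph V).edgeFinset
  let X : Finset (Sym2 V) := Finset.univ.image P
  have hE : E.card = (Fintype.card V).choose 2 :=
    SimpleGraph.card_edgeFinset_top_eq_card_choose_two
  have hX : X.card = s * m := by simp [X, Finset.card_image_of_injective _ hP]
  have hXE : X ⊆ E := by
    intro e he
    obtain ⟨p, -, rfl⟩ := Finset.mem_image.mp he
    simp [E, P]
  have hle : s * m ≤ (Fintype.card V).choose 2 := by
    rw [← hE, ← hX]
    exact Finset.card_le_card hXE
  refine ⟨hle, Finset.univ.filter (AlmostJoined φ), fun G hG => (Finset.mem_filter.mp hG).2, ?_⟩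
  have hdom : (starSets s m ×ˢ (E \ X).powerset).card =
      (m * (2 ^ s - 1) + 1) * 2 ^ ((Fintype.card V).choose 2 - s * m) := by
    rw [Finset.card_product, card_starSets, Finset.card_powerset,
      Finset.card_sdiff_of_subset hXE, hE, hX]
  rw [← hdom]
  let Φ : Finset (Fin s × Fin m) × Finset (Sym2 V) → SimpleGraph V :=
    fun q => (SimpleGraph.fromEdgeSet (q.1.image P ∪ q.2 : Finset (Sym2 V)))ᶜ
  have hPX : ∀ p, P p ∈ X := fun p => Finset.mem_image_of_mem P (Finset.mem_univ p)
  refine Finset.card_le_card_of_injOn Φ ?_ ?_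
  · rintro ⟨Q, Y⟩ hq
    simp only [Finset.coe_product, Set.mem_prod, Finset.mem_coe, Finset.mem_powerset] at hq
    obtain ⟨j, hj⟩ := exists_of_mem_starSets hm hq.1
    simp only [Finset.coe_filter, Finset.mem_univ, true_and, Set.mem_ofPred_eq]
    refine ⟨j, fun i k hk => ?_⟩
    have h₁ : P (i, k) ∉ Q.image P := by
      rw [Finset.mem_image]
      rintro ⟨p, hp, h⟩
      exact hk (by simpa [hP h] using hj p hp)
    have h₂ : P (i, k) ∉ Y := fun h => (Finset.mem_sdiff.mp (hq.2 h)).2 (hPX _)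
    have h₃ : P (i, k) ∉ ((Q.image P ∪ Y : Finset (Sym2 V)) : Set (Sym2 V)) := by
      rw [Finset.mem_coe, Finset.mem_union]
      exact not_or.mpr ⟨h₁, h₂⟩
    rw [SimpleGraph.compl_adj, SimpleGraph.fromEdgeSet_adj]
    exact ⟨by simp, fun h => h₃ h.1⟩
  · rintro ⟨Q, Y⟩ hq ⟨Q', Y'⟩ hq' h
    simp only [Finset.coe_product, Set.mem_prod, Finset.mem_coe, Finset.mem_powerset] at hq hq'
    have key : ∀ e ∈ E, (e ∈ Q.image P ∪ Y ↔ e ∈ Q'.image P ∪ Y') := by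
      intro e he
      have h' := congrArg SimpleGraph.edgeSet (compl_injective h)
      simp only [SimpleGraph.edgeSet_fromEdgeSet] at h'
      have hd : ¬ e.IsDiag := by simpa [E] using he
      have := Set.ext_iff.mp h' e
      simpa only [Set.mem_sdiff, Finset.mem_coe, Sym2.mem_diagSet, hd, not_false_eq_true,
        and_true] using this
    have himage : ∀ R : Finset (Fin s × Fin m), R.image P ⊆ X := fun R =>
      Finset.image_subset_image (Finset.subset_univ R)
    have hQ : Q = Q' := by
      ext p
      have hp : ∀ Z ⊆ E \ X, P p ∉ Z := fun Z hZ h => (Finset.mem_sdiff.mp (hZ h)).2 (hPX _)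
      have := key (P p) (hXE (hPX p))
      simpa [hp Y hq.2, hp Y' hq'.2, hP.mem_finset_image, -Finset.mem_image] using this
    have hY : Y = Y' := by
      ext e
      by_cases he : e ∈ E \ X
      · have hn : ∀ R : Finset (Fin s × Fin m), e ∉ R.image P := fun R hR =>
          (Finset.mem_sdiff.mp he).2 (himage R hR)
        have := key e (Finset.mem_sdiff.mp he).1
        simpa only [Finset.mem_union, hn, false_or] using this
      · exact iff_of_false (fun h => he (hq.2 h)) (fun h => he (hq'.2 h))
    rw [hQ, hY]

theorem two_pow_add_le_two_pow_two_mul {s : ℕ} (hs : 1 ≤ s) :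
    2 ^ s + 2 * s ≤ 2 ^ (2 * s) := by
  induction s, hs using Nat.le_induction with
  | base => norm_num
  | succ k hk ih =>
    rw [show 2 * (k + 1) = 2 * k + 2 by ring, pow_succ 2 k, pow_add 2 (2 * k) 2]
    have := Nat.two_pow_pos k
    omega

/-- For positive integers `s, t` with `t > 2^(2s) - 2s - 1` and `n ≥ 3s + t`, there is a
`K_{s,t}`-intersecting family `𝓕` of labelled graphs on `n` vertices with
`|𝓕| > 2^(C(n,2) - st)`. (A copy of `K_{s,t}` in `G` is an injective graph homomorphism
from the complete bipartite graph `K_{s,t}` to `G`.) -/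
theorem stmt_7 (s t n : ℕ) (hs : 1 ≤ s) (ht1 : 1 ≤ t)
    (ht : 2 ^ (2 * s) - 2 * s - 1 < t) (hn : 3 * s + t ≤ n) :
    ∃ 𝓕 : Finset (SimpleGraph (Fin n)),
      (∀ G₁ ∈ 𝓕, ∀ G₂ ∈ 𝓕,
        ∃ f : Fin s ⊕ Fin t → Fin n, Function.Injective f ∧
          ∀ a b, (completeBipartiteGraph (Fin s) (Fin t)).Adj a b →
            (G₁ ⊓ G₂).Adj (f a) (f b)) ∧
      2 ^ (n.choose 2 - s * t) < 𝓕.card := by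
  obtain ⟨φ⟩ : Nonempty (Fin s ⊕ Fin (t + 2) ↪ Fin n) :=
    Function.Embedding.nonempty_of_card_le (by simp; omega)
  obtain ⟨hle, 𝓕, h𝓕, hcard⟩ := exists_almostJoined_family (by omega) φ
  refine ⟨𝓕, fun G₁ h₁ G₂ h₂ => (h𝓕 G₁ h₁).exists_copy (h𝓕 G₂ h₂), ?_⟩
  rw [Fintype.card_fin] at hle hcard
  have hexp : n.choose 2 - s * t = 2 * s + (n.choose 2 - s * (t + 2)) := by
    rw [mul_add] at hle ⊢
    omega
  have hst : 2 ^ s ≤ t := by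
    have := two_pow_add_le_two_pow_two_mul hs
    omega
  have hlt : 2 ^ (2 * s) < (t + 2) * (2 ^ s - 1) + 1 := by
    obtain ⟨q, hq⟩ : ∃ q, 2 ^ s = q + 1 := ⟨2 ^ s - 1, by have := Nat.two_pow_pos s; omega⟩
    have : 2 ≤ 2 ^ s := le_self_pow (by norm_num) (by omega)
    rw [mul_comm 2 s, pow_mul, hq, Nat.add_sub_cancel]
    nlinarith
  refine lt_of_lt_of_le ?_ hcard
  rw [hexp, pow_add]
  exact (Nat.mul_lt_mul_right (Nat.two_pow_pos _)).mpr hlt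
end

section
/- Let r ≥ 1 and let s₁, …, s_r, t be integers with sᵢ ≥ 1 for 1 ≤ i ≤ r, set S = s₁ + ⋯ + s_r, and suppose t > 2^{2S} - 2S - 1 and n ≥ 3S + t. Then there exists a K_{s₁,…,s_r,t}-intersecting family 𝓗 of labelled graphs on n vertices with |𝓗| > 2^{C(n,2) - Σ_{1≤i<j≤r} sᵢsⱼ - S·t}. -/
open Finset in
/-- The functions `B → P` that differ from a constant `c` in at most `k` places number more than
`C(|B|, k) * (|P| - 1) ^ k`. -/
theorem choose_mul_pow_lt_card_filter_ne {B P : Type*} [Fintype B] [DecidableEq B] [Fintype P]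
    [DecidableEq P] (c : P) {k : ℕ} (hk : 0 < k) :
    (Fintype.card B).choose k * (Fintype.card P - 1) ^ k <
      #{g : B → P | #{b | g b ≠ c} ≤ k} := by
  let F : Finset B → Finset (B → P) := fun D =>
    Fintype.piFinset fun b => if b ∈ D then {c}ᶜ else {c}
  have mem_F (D : Finset B) (g : B → P) : g ∈ F D ↔ ({b | g b ≠ c} : Finset B) = D := by
    simp only [F, Fintype.mem_piFinset, Finset.ext_iff, mem_filter, mem_univ, true_and]
    refine forall_congr' fun b => ?_
    by_cases hb : b ∈ D <;> simp [hb]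
  have card_F (D : Finset B) : #(F D) = (Fintype.card P - 1) ^ #D := by
    have h (b : B) : #(if b ∈ D then ({c}ᶜ : Finset P) else {c}) =
        if b ∈ D then Fintype.card P - 1 else 1 := by
      split_ifs <;> simp [card_compl]
    simp only [F, Fintype.card_piFinset, h]
    simp
  have hcard : #((powersetCard k univ).biUnion F) =
      (Fintype.card B).choose k * (Fintype.card P - 1) ^ k := by
    rw [card_biUnion]
    · rw [sum_congr rfl fun D hD => (card_F D).trans (by rw [(mem_powersetCard.1 hD).2])]
      simp
    · intro D _ D' _ hne
      rw [Function.onFun, disjoint_left]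
      intro g hg hg'
      exact hne (((mem_F D g).1 hg).symm.trans ((mem_F D' g).1 hg'))
  rw [← hcard]
  refine card_lt_card ((ssubset_iff_of_subset ?_).2 ⟨fun _ => c, by simp, ?_⟩)
  · intro g hg
    obtain ⟨D, hD, hg⟩ := mem_biUnion.1 hg
    rw [mem_filter, (mem_F D g).1 hg]
    exact ⟨mem_univ _, (mem_powersetCard.1 hD).2.le⟩
  · intro h
    obtain ⟨D, hD, hg⟩ := mem_biUnion.1 h
    have h0 := (mem_F D _).1 hg
    have h1 := (mem_powersetCard.1 hD).2
    simp only [ne_eq, not_true_eq_false, filter_false] at h0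
    rw [← h0, card_empty] at h1
    omega

theorem Nat.pow_le_choose_mul_pow {m k : ℕ} (h : k ≤ m) : m ^ k ≤ m.choose k * k ^ k := by
  induction k generalizing m with
  | zero => simp
  | succ k ih =>
    obtain ⟨m, rfl⟩ : ∃ l, m = l + 1 := ⟨m - 1, by omega⟩
    have hkm : k ≤ m := by omega
    have key : (m + 1) ^ k ≤ m.choose k * (k + 1) ^ k := by
      rcases Nat.eq_zero_or_pos k with rfl | hk
      · simp
      refine Nat.le_of_mul_le_mul_right ?_ (pow_pos hk k)
      calc (m + 1) ^ k * k ^ k = ((m + 1) * k) ^ k := (mul_pow _ _ _).symm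
        _ ≤ (m * (k + 1)) ^ k := Nat.pow_le_pow_left (by nlinarith) k
        _ = m ^ k * (k + 1) ^ k := mul_pow _ _ _
        _ ≤ m.choose k * k ^ k * (k + 1) ^ k := Nat.mul_le_mul_right _ (ih hkm)
        _ = m.choose k * (k + 1) ^ k * k ^ k := by ring
    calc (m + 1) ^ (k + 1) = (m + 1) * (m + 1) ^ k := by ring
      _ ≤ (m + 1) * (m.choose k * (k + 1) ^ k) := Nat.mul_le_mul_left _ key
      _ = (m + 1) * m.choose k * (k + 1) ^ k := by ring
      _ = (m + 1).choose (k + 1) * (k + 1) * (k + 1) ^ k := by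
        rw [Nat.add_one_mul_choose_eq]
      _ = _ := by ring

open Finset in
/-- Prescribing the edges `P` inside `A` and the possible adjacencies `Q` between `A` and `B`
leaves all other pairs of vertices free. -/
theorem SimpleGraph.card_mul_two_pow_le_card_filter {V A B : Type*} [Fintype V] [DecidableEq V]
    [Fintype A] [DecidableEq A] [Fintype B] [DecidableEq B] (φ : A ⊕ B ↪ V)
    (P : Finset (A × A)) (hP : ∀ x y, (x, y) ∈ P → (y, x) ∉ P) (Q : Finset (B → Finset A))
    (𝓗 : Finset (SimpleGraph V))
    (h𝓗 : ∀ G : SimpleGraph V, (∀ p ∈ P, G.Adj (φ (.inl p.1)) (φ (.inl p.2))) →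
      (∃ g ∈ Q, ∀ a b, a ∈ g b ↔ G.Adj (φ (.inl a)) (φ (.inr b))) → G ∈ 𝓗) :
    #P + Fintype.card A * Fintype.card B ≤ (Fintype.card V).choose 2 ∧
    #Q * 2 ^ ((Fintype.card V).choose 2 - (#P + Fintype.card A * Fintype.card B)) ≤ #𝓗 := by
  let E : Finset (Sym2 V) := (⊤ : SimpleGraph V).edgeFinset
  have hE : #E = (Fintype.card V).choose 2 := SimpleGraph.card_edgeFinset_top_eq_card_choose_two
  let K₁ : Finset (Sym2 V) := P.image fun p => s(φ (.inl p.1), φ (.inl p.2))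
  let K₂ : Finset (Sym2 V) :=
    (univ : Finset (A × B)).image fun p => s(φ (.inl p.1), φ (.inr p.2))
  have hK₁ : #K₁ = #P := by
    refine card_image_of_injOn ?_
    rintro ⟨x, y⟩ h ⟨x', y'⟩ h' heq
    simp only [Sym2.eq_iff, EmbeddingLike.apply_eq_iff_eq, Sum.inl.injEq] at heq
    rcases heq with ⟨rfl, rfl⟩ | ⟨rfl, rfl⟩
    · rfl
    · exact absurd h' (hP _ _ h)
  have hK₂ : #K₂ = Fintype.card A * Fintype.card B := by
    rw [card_image_of_injective, card_univ, Fintype.card_prod]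
    rintro ⟨x, y⟩ ⟨x', y'⟩ heq
    simpa [Sym2.eq_iff] using heq
  have hdisj : Disjoint K₁ K₂ := by
    rw [Finset.disjoint_left]
    intro e h₁ h₂
    obtain ⟨p, -, rfl⟩ := mem_image.1 h₁
    obtain ⟨q, -, h⟩ := mem_image.1 h₂
    simp at h
  have hirr (x : A) : (x, x) ∉ P := fun h => hP _ _ h h
  have hsub : K₁ ∪ K₂ ⊆ E := by
    intro e he
    rcases mem_union.1 he with he | he
    · obtain ⟨⟨x, y⟩, hp, rfl⟩ := mem_image.1 he
      have : x ≠ y := by rintro rfl; exact hirr _ hp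
      simpa [E] using this
    · obtain ⟨⟨x, y⟩, -, rfl⟩ := mem_image.1 he
      simp [E]
  have hK : #(K₁ ∪ K₂) = #P + Fintype.card A * Fintype.card B := by
    rw [card_union_of_disjoint hdisj, hK₁, hK₂]
  refine ⟨by rw [← hK, ← hE]; exact card_le_card hsub, ?_⟩
  let R := E \ (K₁ ∪ K₂)
  have hR : #R = (Fintype.card V).choose 2 - (#P + Fintype.card A * Fintype.card B) := by
    rw [card_sdiff_of_subset hsub, hE, hK]
  rw [← hR, ← card_powerset, ← card_product]
  let F : (B → Finset A) × Finset (Sym2 V) → Set (Sym2 V) := fun q =>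
    {e | e ∈ K₁ ∨ (∃ a b, a ∈ q.1 b ∧ s(φ (.inl a), φ (.inr b)) = e) ∨ e ∈ q.2}
  have hFE {q} (hq : q.2 ⊆ R) {e} (he : e ∈ F q) : ¬ e.IsDiag := by
    have : e ∈ E := by
      rcases he with he | ⟨a, b, -, rfl⟩ | he
      · exact hsub (mem_union_left _ he)
      · exact hsub (mem_union_right _ (mem_image.2 ⟨(a, b), mem_univ _, rfl⟩))
      · exact (mem_sdiff.1 (hq he)).1
    simpa [E] using this
  have hedge {q} (hq : q.2 ⊆ R) : (fromEdgeSet (F q)).edgeSet = F q := by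
    rw [edgeSet_fromEdgeSet, sdiff_eq_left, Set.disjoint_left]
    exact fun e he => hFE hq he
  have hmem {q} (hq : q.2 ⊆ R) (a b) :
      a ∈ q.1 b ↔ s(φ (.inl a), φ (.inr b)) ∈ F q := by
    refine ⟨fun h => .inr (.inl ⟨a, b, h, rfl⟩), ?_⟩
    have h2 : s(φ (.inl a), φ (.inr b)) ∈ K₂ := mem_image.2 ⟨(a, b), mem_univ _, rfl⟩
    rintro (h | ⟨a', b', h, heq⟩ | h)
    · exact absurd h2 (Finset.disjoint_left.1 hdisj h)
    · simp only [Sym2.eq_iff, EmbeddingLike.apply_eq_iff_eq, Sum.inl.injEq, Sum.inr.injEq,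
        reduceCtorEq, and_self, or_false] at heq
      obtain ⟨rfl, rfl⟩ := heq
      exact h
    · exact absurd (mem_union_right _ h2) (mem_sdiff.1 (hq h)).2
  have hfree {q} (hq : q.2 ⊆ R) (e) : e ∈ q.2 ↔ e ∈ R ∧ e ∈ F q := by
    refine ⟨fun h => ⟨hq h, .inr (.inr h)⟩, ?_⟩
    rintro ⟨hR, h | ⟨a, b, -, rfl⟩ | h⟩
    · exact absurd (mem_union_left _ h) (mem_sdiff.1 hR).2
    · exact absurd (mem_union_right _ (mem_image.2 ⟨(a, b), mem_univ _, rfl⟩))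
        (mem_sdiff.1 hR).2
    · exact h
  refine card_le_card_of_injOn (fun q => fromEdgeSet (F q)) ?_ ?_
  · rintro q hq
    obtain ⟨hq1, hq2⟩ := mem_product.1 hq
    rw [mem_powerset] at hq2
    refine h𝓗 _ (fun p hp => ?_) ⟨q.1, hq1, fun a b => ?_⟩
    · rw [← mem_edgeSet, hedge hq2]
      exact .inl (mem_image.2 ⟨p, hp, rfl⟩)
    · rw [← mem_edgeSet, hedge hq2]
      exact hmem hq2 a b
  · rintro q hq q' hq' heq
    have h2 := mem_powerset.1 (mem_product.1 hq).2
    have h2' := mem_powerset.1 (mem_product.1 hq').2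
    have hF : F q = F q' := by
      rw [← hedge h2, ← hedge h2']
      exact congrArg edgeSet heq
    refine Prod.ext ?_ ?_
    · ext b a
      rw [hmem h2, hmem h2', hF]
    · ext e
      rw [hfree h2, hfree h2', hF]

/-- The index type of the parts `s₁, …, s_r, t` embeds into that of `s₁, …, s_r` plus `Fin t`,
respecting the parts. -/
theorem exists_injective_sigma_fin_to_sum {r t : ℕ} (s : Fin r → ℕ) (sizes : Fin (r + 1) → ℕ)
    (hsizes : ∀ i : Fin (r + 1), sizes i = if h : (i : ℕ) < r then s ⟨i, h⟩ else t) :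
    ∃ ψ : (Σ i : Fin (r + 1), Fin (sizes i)) → (Σ i : Fin r, Fin (s i)) ⊕ Fin t,
      Function.Injective ψ ∧ ∀ x,
        Sum.elim (fun a => a.1.castSucc) (fun _ => Fin.last r) (ψ x) = x.1 := by
  refine ⟨fun x => if h : (x.1 : ℕ) < r
    then .inl ⟨⟨x.1, h⟩, Fin.cast (by rw [hsizes, dif_pos h]) x.2⟩
    else .inr (Fin.cast (by rw [hsizes, dif_neg h]) x.2), ?_, ?_⟩
  · rintro ⟨i, x⟩ ⟨j, y⟩ h
    by_cases hi : (i : ℕ) < r <;> by_cases hj : (j : ℕ) < r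
    · simp only [hi, hj, dif_pos, Sum.inl.injEq, Sigma.mk.injEq, Fin.mk.injEq] at h
      obtain ⟨h1, h2⟩ := h
      obtain rfl := Fin.ext h1
      simpa using h2
    · simp [hi, hj] at h
    · simp [hi, hj] at h
    · obtain rfl : i = j := Fin.ext (by omega)
      simpa [hi] using h
  · rintro ⟨i, x⟩
    by_cases hi : (i : ℕ) < r
    · simp [hi]
    · simp only [hi, dif_neg, not_false_eq_true, Sum.elim_inr]
      exact Fin.ext (by simp; omega)


/-- For `r ≥ 1`, integers `s₁, …, s_r ≥ 1` with sum `S`, and `t > 2^(2S) - 2S - 1`,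
`n ≥ 3S + t`, there is a `K_{s₁,…,s_r,t}`-intersecting family `𝓗` of labelled graphs on
`n` vertices with `|𝓗| > 2^(C(n,2) - Σ_{i<j} sᵢsⱼ - S·t)`. Here the complete multipartite
graph `K_{s₁,…,s_r,t}` has parts of sizes `s₁, …, s_r, t`, and a copy of it in `G` is an
injective graph homomorphism into `G`. -/
theorem stmt_8 (r t n : ℕ) (hr : 1 ≤ r) (s : Fin r → ℕ) (hs : ∀ i, 1 ≤ s i)
    (ht : 2 ^ (2 * ∑ i, s i) - 2 * (∑ i, s i) - 1 < t)
    (hn : 3 * (∑ i, s i) + t ≤ n)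
    (sizes : Fin (r + 1) → ℕ)
    (hsizes : ∀ i : Fin (r + 1), sizes i = if h : (i : ℕ) < r then s ⟨i, h⟩ else t) :
    ∃ 𝓗 : Finset (SimpleGraph (Fin n)),
      (∀ G₁ ∈ 𝓗, ∀ G₂ ∈ 𝓗,
        ∃ f : (Σ i : Fin (r + 1), Fin (sizes i)) → Fin n, Function.Injective f ∧
          ∀ a b, (SimpleGraph.completeMultipartiteGraph
              (fun i : Fin (r + 1) => Fin (sizes i))).Adj a b →
            (G₁ ⊓ G₂).Adj (f a) (f b)) ∧
      2 ^ (n.choose 2 - (∑ i, ∑ j, if i < j then s i * s j else 0) - (∑ i, s i) * t) <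
        𝓗.card := by
  classical
  set S := ∑ i, s i with hS
  have hS0 : 0 < S := by
    have := Finset.single_le_sum (f := s) (fun i _ => Nat.zero_le _) (Finset.mem_univ ⟨0, hr⟩)
    have := hs ⟨0, hr⟩
    omega
  have hm : 2 ^ (2 * S) ≤ t + 2 * S := by omega
  have hSlt : S < 2 ^ S := Nat.lt_two_pow_self
  let A := Σ i : Fin r, Fin (s i)
  let B := Fin (t + 2 * S)
  have hA : Fintype.card A = S := by simp [A, hS]
  have hB : Fintype.card B = t + 2 * S := by simp [B]
  obtain ⟨φ⟩ : Nonempty (A ⊕ B ↪ Fin n) := by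
    refine Function.Embedding.nonempty_of_card_le ?_
    rw [Fintype.card_sum, hA, hB, Fintype.card_fin]
    omega
  let P : Finset (A × A) := {p | p.1.1 < p.2.1}
  have hPcard : P.card = ∑ i, ∑ j, if i < j then s i * s j else 0 := by
    simp only [P, Finset.card_filter, Fintype.sum_prod_type, A, Fintype.sum_sigma]
    simp only [Finset.sum_boole, Finset.filter_const, Finset.sum_const, Finset.card_univ,
      Fintype.card_fin, smul_eq_mul, Nat.cast_id, Finset.mul_sum]
    refine Finset.sum_congr rfl fun i _ => Finset.sum_congr rfl fun j _ => ?_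
    split_ifs <;> simp
  let Q : Finset (B → Finset A) := {g | (Finset.univ.filter fun b => g b ≠ .univ).card ≤ S}
  have hQ : 2 ^ (2 * S * S) < Q.card := by
    refine lt_of_le_of_lt ?_ (choose_mul_pow_lt_card_filter_ne (Finset.univ : Finset A) hS0)
    rw [Fintype.card_finset, hA, hB]
    calc 2 ^ (2 * S * S) = (2 ^ (2 * S)) ^ S := pow_mul _ _ _
      _ ≤ (t + 2 * S) ^ S := Nat.pow_le_pow_left hm S
      _ ≤ (t + 2 * S).choose S * S ^ S := Nat.pow_le_choose_mul_pow (by omega)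
      _ ≤ _ := Nat.mul_le_mul_left _ (Nat.pow_le_pow_left (by omega) S)
  let nb (G : SimpleGraph (Fin n)) (b : B) : Finset A :=
    {a | G.Adj (φ (.inl a)) (φ (.inr b))}
  let 𝓗 : Finset (SimpleGraph (Fin n)) :=
    {G | (∀ p ∈ P, G.Adj (φ (.inl p.1)) (φ (.inl p.2))) ∧ nb G ∈ Q}
  refine ⟨𝓗, fun G₁ h₁ G₂ h₂ => ?_, ?_⟩
  · simp only [𝓗, Finset.mem_filter, Finset.mem_univ, true_and, Q] at h₁ h₂
    let bad (G : SimpleGraph (Fin n)) : Finset B := {b | nb G b ≠ .univ}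
    obtain ⟨e⟩ : Nonempty (Fin t ↪ {b // b ∈ (bad G₁ ∪ bad G₂)ᶜ}) := by
      refine Function.Embedding.nonempty_of_card_le ?_
      have h : (bad G₁ ∪ bad G₂).card ≤ S + S :=
        (Finset.card_union_le _ _).trans (add_le_add h₁.2 h₂.2)
      rw [Fintype.card_fin, Fintype.card_coe, Finset.card_compl, hB]
      omega
    have hinl (a a' : A) (h : a.1 ≠ a'.1) : (G₁ ⊓ G₂).Adj (φ (.inl a)) (φ (.inl a')) := by
      rcases h.lt_or_gt with h | h
      · exact ⟨h₁.1 (a, a') (by simpa [P] using h), h₂.1 (a, a') (by simpa [P] using h)⟩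
      · exact SimpleGraph.Adj.symm
          ⟨h₁.1 (a', a) (by simpa [P] using h), h₂.1 (a', a) (by simpa [P] using h)⟩
    have hinr (a : A) (k : Fin t) : (G₁ ⊓ G₂).Adj (φ (.inl a)) (φ (.inr (e k))) := by
      have h := (e k).2
      simp only [Finset.compl_union, Finset.mem_inter, Finset.mem_compl, bad, Finset.mem_filter,
        Finset.mem_univ, true_and, not_not, Finset.eq_univ_iff_forall, nb] at h
      exact ⟨h.1 a, h.2 a⟩
    obtain ⟨ψ, hψ, hpart⟩ := exists_injective_sigma_fin_to_sum s sizes hsizes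
    refine ⟨fun x => φ (Sum.map id (fun k => (e k : B)) (ψ x)), ?_, fun x y hxy => ?_⟩
    · exact φ.injective.comp ((Function.injective_id.sumMap
        (Subtype.val_injective.comp e.injective)).comp hψ)
    · have hne : x.1 ≠ y.1 := hxy
      rw [← hpart x, ← hpart y] at hne
      cases hx : ψ x with
      | inl a =>
        cases hy : ψ y with
        | inl a' =>
          simpa only [hx, hy, Sum.map_inl, Sum.map_inr, id] using
            hinl a a' fun h => hne (by simp [hx, hy, h])
        | inr k => simpa only [hx, hy, Sum.map_inl, Sum.map_inr, id] using hinr a k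
      | inr k =>
        cases hy : ψ y with
        | inl a => simpa only [hx, hy, Sum.map_inl, Sum.map_inr, id] using (hinr a k).symm
        | inr k' => exact absurd (by simp [hx, hy]) hne
  · obtain ⟨hle, hcard⟩ := SimpleGraph.card_mul_two_pow_le_card_filter φ P
      (fun x y h h' => by
        simp only [P, Finset.mem_filter, Finset.mem_univ, true_and] at h h'
        exact lt_asymm h h') Q 𝓗 (fun G hG ⟨g, hg, hgG⟩ => by
        have : nb G = g := by ext b a; simp [nb, hgG]
        simpa [𝓗, this, hg] using hG)
    rw [hPcard, hA, hB, Fintype.card_fin] at hle hcard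
    refine lt_of_lt_of_le ?_ hcard
    set p := ∑ i, ∑ j, if i < j then s i * s j else 0
    have hexp : n.choose 2 - p - S * t = 2 * S * S + (n.choose 2 - (p + S * (t + 2 * S))) := by
      have : S * (t + 2 * S) = S * t + 2 * S * S := by ring
      omega
    rw [hexp, pow_add]
    exact Nat.mul_lt_mul_of_pos_right hQ (by positivity)
end

section
/- Let d ≥ 2, t ≥ 1 and 1 ≤ m ≤ d be integers, and let 𝓕 be a nonempty nontrivial d-wise t-intersecting family of subsets of [n]. Then for any sets A₁, …, A_m ∈ 𝓕 (not necessarily distinct), |A₁ ∩ ⋯ ∩ A_m| ≥ t + d - m. -/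
/-- If every `m + k` members of `𝓕` meet in at least `t` points, but all of `𝓕` meets in fewer
than `t`, then any `m ≥ 1` members meet in at least `t + k` points. -/
theorem le_ncard_iInter_of_nontrivial {α : Type*} {t : ℕ} {𝓕 : Set (Finset α)}
    (hnontriv : (⋂ F ∈ 𝓕, (F : Set α)).ncard < t) (k : ℕ) :
    ∀ m : ℕ, 1 ≤ m →
      (∀ G : Fin (m + k) → Finset α, (∀ i, G i ∈ 𝓕) → t ≤ (⋂ i, (G i : Set α)).ncard) →
      ∀ A : Fin m → Finset α, (∀ i, A i ∈ 𝓕) → t + k ≤ (⋂ i, (A i : Set α)).ncard := by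
  induction k with
  | zero => exact fun m _ hint A hA => hint A hA
  | succ k ih =>
    intro m hm hint A hA
    by_contra! hlt
    have hfin : (⋂ i, (A i : Set α)).Finite :=
      (A ⟨0, hm⟩).finite_toSet.subset (Set.iInter_subset _ _)
    have hcons (F : Finset α) (hF : F ∈ 𝓕) :
        t + k ≤ ((F : Set α) ∩ ⋂ i, (A i : Set α)).ncard := by
      have h := ih (m + 1) (by omega) (by rwa [show m + 1 + k = m + (k + 1) by omega])
        (Fin.cons F A) (by simpa [Fin.forall_fin_succ] using ⟨hF, hA⟩)
      convert h using 2
      ext x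
      simp [Fin.forall_fin_succ]
    have hsubset : (⋂ i, (A i : Set α)) ⊆ ⋂ F ∈ 𝓕, (F : Set α) := by
      refine Set.subset_iInter₂ fun F hF => ?_
      have h := hcons F hF
      have hle : (⋂ i, (A i : Set α)).ncard ≤ ((F : Set α) ∩ ⋂ i, (A i : Set α)).ncard := by omega
      rw [← Set.eq_of_subset_of_ncard_le Set.inter_subset_right hle hfin]
      exact Set.inter_subset_left
    have hle := Set.ncard_le_ncard hsubset
      ((A ⟨0, hm⟩).finite_toSet.subset (Set.biInter_subset_of_mem (hA _)))
    have h₁ := hcons _ (hA ⟨0, hm⟩)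
    have h₂ := Set.ncard_le_ncard
      (Set.inter_subset_right (s := (A ⟨0, hm⟩ : Set α)) (t := ⋂ i, (A i : Set α))) hfin
    omega


/-- If `𝓕` is a nonempty nontrivial `d`-wise `t`-intersecting family of subsets of `[n]`
with `d ≥ 2`, `t ≥ 1`, and `1 ≤ m ≤ d`, then any `m` members `A₁, …, A_m ∈ 𝓕` (not
necessarily distinct) satisfy `|A₁ ∩ ⋯ ∩ A_m| ≥ t + d - m`. -/
theorem stmt_9 (n d t m : ℕ) (hd : 2 ≤ d) (ht : 1 ≤ t) (hm1 : 1 ≤ m) (hmd : m ≤ d)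
    (𝓕 : Finset (Finset ℕ)) (hne : 𝓕.Nonempty)
    (hsub : ∀ F ∈ 𝓕, F ⊆ Finset.Icc 1 n)
    (hint : ∀ G : Fin d → Finset ℕ, (∀ i, G i ∈ 𝓕) → t ≤ (⋂ i, (G i : Set ℕ)).ncard)
    (hnontriv : (⋂ F ∈ (𝓕 : Set (Finset ℕ)), (F : Set ℕ)).ncard < t)
    (A : Fin m → Finset ℕ) (hA : ∀ i, A i ∈ 𝓕) :
    t + d - m ≤ (⋂ i, (A i : Set ℕ)).ncard := by
  obtain ⟨k, rfl⟩ := Nat.exists_eq_add_of_le hmd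
  have h := le_ncard_iInter_of_nontrivial hnontriv k m hm1 hint A hA
  omega
end

section
/- Let d ≥ 2 and t ≥ 1 be integers. If 𝓕 is a nonempty nontrivial d-wise t-intersecting family of subsets of [n], then 𝓕 is (2-wise) (t+d-2)-intersecting, i.e. |F ∩ F'| ≥ t + d - 2 for all F, F' ∈ 𝓕. -/
/-- If the members of `𝓕` have fewer than `t` common elements, then any set with fewer than
`t + k` elements can be cut down to fewer than `t` elements by `k` members of `𝓕`. -/
theorem exists_ncard_inter_iInter_lt {α : Type*} {𝓕 : Set (Finset α)} {t : ℕ} (hne : 𝓕.Nonempty)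
    (h : (⋂ F ∈ 𝓕, (F : Set α)).ncard < t) (k : ℕ) (A : Set α) (hfin : A.Finite)
    (hA : A.ncard < t + k) :
    ∃ G : Fin k → Finset α, (∀ i, G i ∈ 𝓕) ∧ (A ∩ ⋂ i, (G i : Set α)).ncard < t := by
  induction k generalizing A with
  | zero => exact ⟨Fin.elim0, fun i => i.elim0, by simpa using hA⟩
  | succ k ih =>
    obtain ⟨F, hF, hlt⟩ : ∃ F ∈ 𝓕, (A ∩ (F : Set α)).ncard < t + k := by
      by_cases hsub : ∀ F ∈ 𝓕, A ⊆ (F : Set α)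
      · obtain ⟨F, hF⟩ := hne
        have hIfin : (⋂ F ∈ 𝓕, (F : Set α)).Finite :=
          F.finite_toSet.subset (Set.biInter_subset_of_mem hF)
        have hle := Set.ncard_le_ncard (Set.subset_iInter₂ hsub) hIfin
        have hle' := Set.ncard_le_ncard (Set.inter_subset_left (s := A) (t := (F : Set α))) hfin
        exact ⟨F, hF, by omega⟩
      · push Not at hsub
        obtain ⟨F, hF, hAF⟩ := hsub
        have hlt := Set.ncard_lt_ncard (Set.inter_ssubset_left_iff.mpr hAF) hfin
        exact ⟨F, hF, by omega⟩
    obtain ⟨G, hG, hGt⟩ := ih (A ∩ F) (hfin.inter_of_left _) hlt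
    refine ⟨Fin.cons F G, Fin.cases hF hG, ?_⟩
    convert hGt using 2
    ext x
    simp [Fin.forall_fin_succ, and_assoc]


/-- If `𝓕` is a nonempty nontrivial `d`-wise `t`-intersecting family of subsets of `[n]`
with `d ≥ 2` and `t ≥ 1`, then `𝓕` is `(t+d-2)`-intersecting: `|F ∩ F'| ≥ t + d - 2`
for all `F, F' ∈ 𝓕`. -/
theorem stmt_10 (n d t : ℕ) (hd : 2 ≤ d) (ht : 1 ≤ t)
    (𝓕 : Finset (Finset ℕ)) (hne : 𝓕.Nonempty)
    (hsub : ∀ F ∈ 𝓕, F ⊆ Finset.Icc 1 n)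
    (hint : ∀ G : Fin d → Finset ℕ, (∀ i, G i ∈ 𝓕) → t ≤ (⋂ i, (G i : Set ℕ)).ncard)
    (hnontriv : (⋂ F ∈ (𝓕 : Set (Finset ℕ)), (F : Set ℕ)).ncard < t) :
    ∀ F ∈ 𝓕, ∀ F' ∈ 𝓕, t + d - 2 ≤ (F ∩ F').card := by
  intro F hF F' hF'
  by_contra! hlt
  obtain ⟨m, rfl⟩ := Nat.exists_eq_add_of_le' hd
  obtain ⟨G, hG, hGt⟩ := exists_ncard_inter_iInter_lt (Finset.coe_nonempty.mpr hne) hnontriv m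
    ((F ∩ F' : Finset ℕ) : Set ℕ) (Finset.finite_toSet _) (by rw [Set.ncard_coe_finset]; omega)
  have hle := hint (Fin.cons F (Fin.cons F' G)) (Fin.cases hF (Fin.cases hF' hG))
  refine hGt.not_ge (hle.trans_eq ?_)
  congr 1
  ext x
  simp [Fin.forall_fin_succ, and_assoc]
end

section
/- Let t ≥ 2 and d ≥ 3 be integers, let β be a real number with 0 < β < 1/2 satisfying (1-β)^{t+d-3} = β^{d-2}, and let p be a rational number with 0 < p < β. Then there exists n₀ such that for all integers n > n₀ and k with k = p·n (in particular p·n is an integer), C(n-t, k-t) > C(n-1, k-t-d+2). -/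
/-- A power comparison that forces one binomial coefficient to be smaller than another. -/
theorem choose_lt_choose_of_pow_mul_pow_lt (a c m r : ℕ)
    (h : (a + m + c + r) ^ r * (a + m) ^ m < (c + 1) ^ (m + r)) :
    (a + m + c + r).choose a < (a + m + c).choose (a + m) := by
  have h1 := Nat.add_choose_mul_factorial_mul_factorial (a + m) c
  rw [← Nat.choose_symm_add] at h1
  have h2 := Nat.add_choose_mul_factorial_mul_factorial a (c + (m + r))
  rw [← Nat.choose_symm_add, show a + (c + (m + r)) = a + m + c + r by ring] at h2
  have h3 : (a + m + c + r).factorial ≤ (a + m + c).factorial * (a + m + c + r) ^ r := by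
    rw [← Nat.factorial_mul_ascFactorial]
    exact Nat.mul_le_mul_left _ (Nat.ascFactorial_le_pow_add _ _)
  have h4 : (a + m).factorial ≤ a.factorial * (a + m) ^ m := by
    rw [← Nat.factorial_mul_ascFactorial]
    exact Nat.mul_le_mul_left _ (Nat.ascFactorial_le_pow_add _ _)
  have h5 : c.factorial * (c + 1) ^ (m + r) ≤ (c + (m + r)).factorial :=
    Nat.factorial_mul_pow_le_factorial
  have hpos : 0 < (a + m + c).factorial * a.factorial * c.factorial := by positivity
  refine lt_of_mul_lt_mul_right (a := a.factorial * (c + (m + r)).factorial *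
    ((a + m).factorial * c.factorial)) ?_ (Nat.zero_le _)
  calc (a + m + c + r).choose a * (a.factorial * (c + (m + r)).factorial *
        ((a + m).factorial * c.factorial))
      = (a + m + c + r).factorial * (a + m).factorial * c.factorial := by rw [← h2]; ring
    _ ≤ ((a + m + c).factorial * (a + m + c + r) ^ r) * (a.factorial * (a + m) ^ m) *
        c.factorial := by gcongr
    _ = (a + m + c).factorial * a.factorial * c.factorial *
        ((a + m + c + r) ^ r * (a + m) ^ m) := by ring
    _ < (a + m + c).factorial * a.factorial * c.factorial * (c + 1) ^ (m + r) :=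
        Nat.mul_lt_mul_of_pos_left h hpos
    _ = (a + m + c).factorial * a.factorial * (c.factorial * (c + 1) ^ (m + r)) := by ring
    _ ≤ (a + m + c).factorial * a.factorial * (c + (m + r)).factorial := by gcongr
    _ = (a + m + c).choose (a + m) * (a.factorial * (c + (m + r)).factorial *
        ((a + m).factorial * c.factorial)) := by rw [← h1]; ring

/-- For integers `t ≥ 2`, `d ≥ 3`, a real `β ∈ (0, 1/2)` with `(1-β)^(t+d-3) = β^(d-2)`,
and a rational `p` with `0 < p < β`, there is `n₀` such that for all `n > n₀` and `k`
with `k = p·n`, we have `C(n-t, k-t) > C(n-1, k-t-d+2)`. -/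
theorem stmt_11 (t d : ℕ) (ht : 2 ≤ t) (hd : 3 ≤ d)
    (β : ℝ) (hβ0 : 0 < β) (hβ2 : β < 1 / 2)
    (hβ : (1 - β) ^ (t + d - 3) = β ^ (d - 2))
    (p : ℚ) (hp0 : 0 < p) (hpβ : (p : ℝ) < β) :
    ∃ n₀ : ℕ, ∀ n k : ℕ, n₀ < n → (k : ℚ) = p * n →
      (n - 1).choose (k - t - d + 2) < (n - t).choose (k - t) := by
  obtain ⟨n₀, hn₀⟩ := exists_nat_gt (((t + d : ℕ) : ℚ) / p)
  refine ⟨n₀, fun n k hn hk => ?_⟩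
  have hp0' : (0 : ℝ) < p := by exact_mod_cast hp0
  have hkR : (k : ℝ) = p * n := by exact_mod_cast hk
  have hktd : t + d ≤ k := by
    have h1 : ((t + d : ℕ) : ℚ) < n₀ * p := (div_lt_iff₀ hp0).1 hn₀
    have h2 : (n₀ : ℚ) * p ≤ n * p := by gcongr
    have h3 : ((t + d : ℕ) : ℚ) < k := by rw [hk]; linarith
    exact_mod_cast h3.le
  have hkn : k ≤ n := by
    have h : (k : ℝ) ≤ n := by
      rw [hkR]
      exact mul_le_of_le_one_left (Nat.cast_nonneg n) (by linarith)
    exact_mod_cast h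
  obtain ⟨m, rfl⟩ := Nat.exists_eq_add_of_le' (show 2 ≤ d by omega)
  obtain ⟨r, rfl⟩ := Nat.exists_eq_add_of_le' (show 1 ≤ t by omega)
  obtain ⟨c, rfl⟩ := Nat.exists_eq_add_of_le hkn
  obtain ⟨a, rfl⟩ := Nat.exists_eq_add_of_le' (show m + r + 1 ≤ k by omega)
  rw [show r + 1 + (m + 2) - 3 = m + r by omega, show m + 2 - 2 = m by omega] at hβ
  have hpow : (p : ℝ) ^ m ≤ (1 - p) ^ (m + r) :=
    calc (p : ℝ) ^ m ≤ β ^ m := by gcongr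
      _ = (1 - β) ^ (m + r) := hβ.symm
      _ ≤ (1 - p) ^ (m + r) := by
        have : (0 : ℝ) ≤ 1 - β := by linarith
        gcongr
  set k := a + (m + r + 1) with hk_def
  have hc : (c : ℝ) = (1 - p) * (k + c : ℕ) := by
    rw [sub_mul, one_mul, ← hkR]; push_cast; ring
  have hmain : (k + c) ^ r * k ^ m ≤ c ^ (m + r) := by
    have h : (((k + c : ℕ) : ℝ)) ^ r * (k : ℝ) ^ m ≤ (c : ℝ) ^ (m + r) := by
      rw [hc, hkR, mul_pow, mul_pow]
      calc (((k + c : ℕ) : ℝ)) ^ r * ((p : ℝ) ^ m * ((k + c : ℕ) : ℝ) ^ m)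
          = (p : ℝ) ^ m * ((k + c : ℕ) : ℝ) ^ (m + r) := by ring
        _ ≤ (1 - (p : ℝ)) ^ (m + r) * ((k + c : ℕ) : ℝ) ^ (m + r) := by gcongr
    exact_mod_cast h
  rw [show k + c - 1 = a + m + c + r by omega, show k - (r + 1) - (m + 2) + 2 = a by omega,
    show k + c - (r + 1) = a + m + c by omega, show k - (r + 1) = a + m by omega]
  apply choose_lt_choose_of_pow_mul_pow_lt
  calc (a + m + c + r) ^ r * (a + m) ^ m ≤ (k + c) ^ r * k ^ m := by
        have hle : a + m + c + r ≤ k + c := by omega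
        have hle' : a + m ≤ k := by omega
        exact Nat.mul_le_mul (Nat.pow_le_pow_left hle r) (Nat.pow_le_pow_left hle' m)
    _ ≤ c ^ (m + r) := hmain
    _ < (c + 1) ^ (m + r) := Nat.pow_lt_pow_left (Nat.lt_succ_self c) (by omega)
end

section
/- The family M(11,7,3,3) := {F ⊆ [11] : |F| = 7, 1 ∈ F, |F ∩ [2,8]| ≥ 4} ∪ {[2,8]} of 7-element subsets of [11] is a nontrivial 3-wise intersecting family, |M(11,7,3,3)| = 176, and max{|A(11,7,3)|, |H(11,7,3)|} = 175. -/
/-- `famA n k d` is the family `A(n,k,d) = {A ⊆ [n] : |A| = k, |A ∩ [d+1]| ≥ d}`. -/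
def famA (n k d : ℕ) : Finset (Finset ℕ) :=
  ((Finset.Icc 1 n).powersetCard k).filter (fun A => d ≤ (A ∩ Finset.Icc 1 (d + 1)).card)

/-- `famH n k d` is the family
`H(n,k,d) = {A ⊆ [n] : |A| = k, [d-1] ⊆ A, A ∩ [d,k+1] ≠ ∅} ∪ {[k+1] \ {i} : i ∈ [d-1]}`. -/
def famH (n k d : ℕ) : Finset (Finset ℕ) :=
  ((Finset.Icc 1 n).powersetCard k).filter
    (fun A => Finset.Icc 1 (d - 1) ⊆ A ∧ (A ∩ Finset.Icc d (k + 1)).Nonempty)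
    ∪ (Finset.Icc 1 (d - 1)).image (fun i => Finset.Icc 1 (k + 1) \ {i})

/-- `M(11,7,3,3) = {F ⊆ [11] : |F| = 7, 1 ∈ F, |F ∩ [2,8]| ≥ 4} ∪ {[2,8]}`. -/
def M11733 : Finset (Finset ℕ) :=
  ((Finset.Icc 1 11).powersetCard 7).filter
    (fun F => 1 ∈ F ∧ 4 ≤ (F ∩ Finset.Icc 2 8).card)
    ∪ {Finset.Icc 2 8}

/-- Membership in `M(11,7,3,3)`. -/
theorem mem_M11733 {F : Finset ℕ} :
    F ∈ M11733 ↔ ((F ⊆ Finset.Icc 1 11 ∧ F.card = 7) ∧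
      1 ∈ F ∧ 4 ≤ (F ∩ Finset.Icc 2 8).card) ∨ F = Finset.Icc 2 8 := by
  simp only [M11733, Finset.mem_union, Finset.mem_filter, Finset.mem_powersetCard,
    Finset.mem_singleton]

/-- Every member of `M(11,7,3,3)` has at least four elements in `[2,8]`. -/
theorem four_le_card_inter_of_mem_M11733 {F : Finset ℕ} (hF : F ∈ M11733) :
    4 ≤ (F ∩ Finset.Icc 2 8).card := by
  rcases mem_M11733.1 hF with h | rfl
  · exact h.2.2
  · simp

/-- Any two members of `M(11,7,3,3)` have a common element in `[2,8]`. -/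
theorem exists_mem_inter_of_mem_M11733 {F F' : Finset ℕ} (hF : F ∈ M11733)
    (hF' : F' ∈ M11733) : ∃ x ∈ Finset.Icc 2 8, x ∈ F ∧ x ∈ F' := by
  have hcard : (Finset.Icc 2 8).card <
      (F ∩ Finset.Icc 2 8).card + (F' ∩ Finset.Icc 2 8).card := by
    have h := four_le_card_inter_of_mem_M11733 hF
    have h' := four_le_card_inter_of_mem_M11733 hF'
    rw [Nat.card_Icc]
    omega
  obtain ⟨x, hx⟩ := Finset.inter_nonempty_of_card_lt_card_add_card
    Finset.inter_subset_right Finset.inter_subset_right hcard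
  simp only [Finset.mem_inter] at hx
  exact ⟨x, hx.1.2, hx.1.1, hx.2.1⟩

/-- The number of `k`-subsets of `U` meeting `S ⊆ U` in exactly `j` elements. -/
theorem card_filter_powersetCard_card_inter_eq {α : Type*} [DecidableEq α] {U S : Finset α}
    (hS : S ⊆ U) {j k : ℕ} (hjk : j ≤ k) :
    ((U.powersetCard k).filter (fun A => (A ∩ S).card = j)).card =
      S.card.choose j * (U.card - S.card).choose (k - j) := by
  rw [← Finset.card_sdiff_of_subset hS, ← Finset.card_powersetCard, ← Finset.card_powersetCard,
    ← Finset.card_product]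
  refine Finset.card_nbij' (fun A => (A ∩ S, A \ S)) (fun p => p.1 ∪ p.2) ?_ ?_ ?_ ?_
  · intro A hA
    simp only [Finset.coe_filter, Set.mem_ofPred_eq, Finset.mem_powersetCard] at hA
    have := Finset.card_inter_add_card_sdiff A S
    simp only [Finset.coe_product, Set.mem_prod, Finset.mem_coe, Finset.mem_powersetCard]
    exact ⟨⟨Finset.inter_subset_right, hA.2⟩, Finset.sdiff_subset_sdiff hA.1.1 subset_rfl,
      by omega⟩
  · rintro ⟨B, C⟩ h
    simp only [Finset.coe_product, Set.mem_prod, Finset.mem_coe, Finset.mem_powersetCard] at h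
    obtain ⟨⟨hB, hBj⟩, hC, hCj⟩ := h
    have hCS : Disjoint C S := Finset.disjoint_of_subset_left hC Finset.sdiff_disjoint
    simp only [Finset.coe_filter, Set.mem_ofPred_eq, Finset.mem_powersetCard]
    refine ⟨⟨Finset.union_subset (hB.trans hS) (hC.trans Finset.sdiff_subset), ?_⟩, ?_⟩
    · rw [Finset.card_union_of_disjoint (Finset.disjoint_of_subset_left hB hCS.symm)]
      omega
    · rw [Finset.union_inter_distrib_right, Finset.inter_eq_left.2 hB,
        Finset.disjoint_iff_inter_eq_empty.1 hCS, Finset.union_empty, hBj]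
  · intro A _
    exact sup_inf_sdiff A S
  · rintro ⟨B, C⟩ h
    simp only [Finset.coe_product, Set.mem_prod, Finset.mem_coe, Finset.mem_powersetCard] at h
    have hCS : Disjoint C S := Finset.disjoint_of_subset_left h.2.1 Finset.sdiff_disjoint
    have hB := h.1.1
    ext x <;> simp only [Finset.mem_inter, Finset.mem_sdiff, Finset.mem_union] <;>
      grind [Finset.disjoint_left]

/-- The number of `k`-subsets of `U` meeting `S ⊆ U` in at least `d` elements. -/
theorem card_filter_powersetCard_le_card_inter {α : Type*} [DecidableEq α] {U S : Finset α}
    (hS : S ⊆ U) (d k : ℕ) :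
    ((U.powersetCard k).filter (fun A => d ≤ (A ∩ S).card)).card =
      ∑ j ∈ Finset.Icc d k, S.card.choose j * (U.card - S.card).choose (k - j) := by
  rw [Finset.card_eq_sum_card_fiberwise (f := fun A => (A ∩ S).card) (t := Finset.Icc d k)]
  · refine Finset.sum_congr rfl fun j hj => ?_
    rw [Finset.mem_Icc] at hj
    rw [← card_filter_powersetCard_card_inter_eq hS hj.2, Finset.filter_filter]
    congr 1
    refine Finset.filter_congr fun A _ => ?_
    omega
  · intro A hA
    simp only [Finset.coe_filter, Set.mem_ofPred_eq, Finset.mem_powersetCard] at hA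
    have := Finset.card_le_card (Finset.inter_subset_left : A ∩ S ⊆ A)
    simp only [Finset.coe_Icc, Set.mem_Icc]
    omega

theorem card_M11733 : M11733.card = 176 := by
  have himage : ((Finset.Icc 1 11).powersetCard 7).filter
      (fun F => 1 ∈ F ∧ 4 ≤ (F ∩ Finset.Icc 2 8).card) =
      (((Finset.Icc 2 11).powersetCard 6).filter
        (fun F => 4 ≤ (F ∩ Finset.Icc 2 8).card)).image (insert 1) := by
    have h1 : (1 : ℕ) ∉ Finset.Icc 2 8 := by simp
    ext F
    simp only [Finset.mem_filter, Finset.mem_powersetCard, Finset.mem_image]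
    constructor
    · rintro ⟨⟨hF, hcard⟩, h1F, h4⟩
      refine ⟨F.erase 1, ⟨⟨fun x hx => ?_, ?_⟩, ?_⟩, Finset.insert_erase h1F⟩
      · have := Finset.mem_Icc.1 (hF (Finset.mem_of_mem_erase hx))
        have := Finset.ne_of_mem_erase hx
        rw [Finset.mem_Icc]
        omega
      · rw [Finset.card_erase_of_mem h1F, hcard]
      · rwa [Finset.erase_inter, Finset.erase_eq_of_notMem (by simp)]
    · rintro ⟨F, ⟨⟨hF, hcard⟩, h4⟩, rfl⟩
      have h1F : 1 ∉ F := fun h => by simpa using hF h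
      refine ⟨⟨Finset.insert_subset (by simp) (hF.trans ?_), ?_⟩, Finset.mem_insert_self 1 F, ?_⟩
      · exact Finset.Icc_subset_Icc (by norm_num) le_rfl
      · rw [Finset.card_insert_of_notMem h1F, hcard]
      · rwa [Finset.insert_inter_of_notMem h1]
  rw [M11733, Finset.card_union_of_disjoint (by simp), himage, Finset.card_image_of_injOn,
    card_filter_powersetCard_le_card_inter (Finset.Icc_subset_Icc le_rfl (by norm_num))]
  · simp only [Nat.card_Icc, Finset.card_singleton]
    decide
  · intro F hF F' hF' h
    simp only [Finset.coe_filter, Set.mem_ofPred_eq, Finset.mem_powersetCard] at hF hF'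
    have h1F : 1 ∉ F := fun h => by simpa using hF.1.1 h
    have h1F' : 1 ∉ F' := fun h => by simpa using hF'.1.1 h
    rw [← Finset.erase_insert h1F, ← Finset.erase_insert h1F']
    exact congrArg (Finset.erase · 1) h

theorem card_famA_eleven_seven_three : (famA 11 7 3).card = 175 := by
  rw [famA, card_filter_powersetCard_le_card_inter (Finset.Icc_subset_Icc le_rfl (by norm_num))]
  simp only [Nat.card_Icc]
  decide

theorem card_famH_eleven_seven_three_le : (famH 11 7 3).card ≤ 128 := by
  refine (Finset.card_union_le _ _).trans (Nat.add_le_add (?_ : _ ≤ 126) Finset.card_image_le)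
  have hcard := card_filter_powersetCard_card_inter_eq
    (Finset.Icc_subset_Icc le_rfl (by norm_num) : Finset.Icc 1 2 ⊆ Finset.Icc 1 11)
    (by norm_num : 2 ≤ 7)
  refine (Finset.card_le_card ?_).trans (hcard.trans_le (by simp only [Nat.card_Icc]; decide))
  refine Finset.monotone_filter_right _ fun A _ hA => ?_
  rw [Finset.inter_eq_right.2 hA.1]
  rfl

/-- `M(11,7,3,3)` is a nontrivial `3`-wise intersecting family of `7`-subsets of `[11]`
of size `176`, while `max {|A(11,7,3)|, |H(11,7,3)|} = 175`. -/
theorem stmt_12 :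
    (∀ F ∈ M11733, F ⊆ Finset.Icc 1 11 ∧ F.card = 7) ∧
    (∀ G : Fin 3 → Finset ℕ, (∀ i, G i ∈ M11733) → (⋂ i, (G i : Set ℕ)).Nonempty) ∧
    (⋂ F ∈ (M11733 : Set (Finset ℕ)), (F : Set ℕ)) = ∅ ∧
    M11733.card = 176 ∧
    max (famA 11 7 3).card (famH 11 7 3).card = 175 := by
  refine ⟨fun F hF => ?_, fun G hG => ?_, ?_, card_M11733, ?_⟩
  · rcases mem_M11733.1 hF with h | rfl
    · exact h.1
    · exact ⟨Finset.Icc_subset_Icc (by norm_num) (by norm_num), by simp⟩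
  · simp only [Set.Nonempty, Set.mem_iInter, Finset.mem_coe, Fin.forall_fin_succ,
      IsEmpty.forall_iff, and_true]
    by_cases h : ∀ i, 1 ∈ G i
    · exact ⟨1, h _, h _, h _⟩
    · push Not at h
      obtain ⟨i, hi⟩ := h
      have hGi : G i = Finset.Icc 2 8 :=
        (mem_M11733.1 (hG i)).resolve_left fun h => hi h.2.1
      fin_cases i
      · obtain ⟨x, hx, h₁, h₂⟩ := exists_mem_inter_of_mem_M11733 (hG 1) (hG 2)
        exact ⟨x, hGi ▸ hx, h₁, h₂⟩
      · obtain ⟨x, hx, h₀, h₂⟩ := exists_mem_inter_of_mem_M11733 (hG 0) (hG 2)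
        exact ⟨x, h₀, hGi ▸ hx, h₂⟩
      · obtain ⟨x, hx, h₀, h₁⟩ := exists_mem_inter_of_mem_M11733 (hG 0) (hG 1)
        exact ⟨x, h₀, h₁, hGi ▸ hx⟩
  · refine Set.eq_empty_of_forall_notMem fun x hx => ?_
    simp only [Set.mem_iInter, Finset.mem_coe] at hx
    have h₁ := hx (Finset.Icc 2 8) (mem_M11733.2 (Or.inr rfl))
    have h₂ := hx {1, 2, 3, 4, 5, 9, 10} (mem_M11733.2 (Or.inl (by decide)))
    have h₃ := hx {1, 5, 6, 7, 8, 9, 10} (mem_M11733.2 (Or.inl (by decide)))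
    have h₄ := hx {1, 2, 3, 4, 6, 9, 10} (mem_M11733.2 (Or.inl (by decide)))
    simp only [Finset.mem_Icc, Finset.mem_insert, Finset.mem_singleton] at h₁ h₂ h₃ h₄
    omega
  · rw [card_famA_eleven_seven_three]
    exact max_eq_left (card_famH_eleven_seven_three_le.trans (by norm_num))
end

section
/- Let n, k, d, r be integers with d ≥ 2, 1 ≤ r ≤ ⌊(k-1)/(d-1)⌋ and n ≥ k+2. Then the family M(n,k,d,r) is a nonempty nontrivial d-wise intersecting family of k-element subsets of [n]. -/
/-- `famM n k d r` is the family
`M(n,k,d,r) = {F ⊆ [n] : |F| = k, 1 ∈ F, |F ∩ [2, 2+(d-1)r]| ≥ 1+(d-2)r}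
               ∪ {F ⊆ [2,n] : |F| = k, [2, 2+(d-1)r] ⊆ F}`. -/
def famM (n k d r : ℕ) : Finset (Finset ℕ) :=
  ((Finset.Icc 1 n).powersetCard k).filter
    (fun F => 1 ∈ F ∧ 1 + (d - 2) * r ≤ (F ∩ Finset.Icc 2 (2 + (d - 1) * r)).card)
    ∪ ((Finset.Icc 2 n).powersetCard k).filter
      (fun F => Finset.Icc 2 (2 + (d - 1) * r) ⊆ F)

theorem mem_famM {n k d r : ℕ} {F : Finset ℕ} :
    F ∈ famM n k d r ↔
      (F ⊆ Finset.Icc 1 n ∧ F.card = k ∧ 1 ∈ F ∧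
        1 + (d - 2) * r ≤ (F ∩ Finset.Icc 2 (2 + (d - 1) * r)).card) ∨
      (F ⊆ Finset.Icc 2 n ∧ F.card = k ∧ Finset.Icc 2 (2 + (d - 1) * r) ⊆ F) := by
  simp [famM, Finset.mem_powersetCard, and_assoc]

theorem famM_subset_and_card {n k d r : ℕ} {F : Finset ℕ} (hF : F ∈ famM n k d r) :
    F ⊆ Finset.Icc 1 n ∧ F.card = k := by
  rcases mem_famM.1 hF with ⟨h, hk, -⟩ | ⟨h, hk, -⟩
  · exact ⟨h, hk⟩
  · exact ⟨h.trans (Finset.Icc_subset_Icc_left one_le_two), hk⟩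

theorem exists_mem_famM_notMem {n k d r : ℕ} (hd : 2 ≤ d) (hr : 1 ≤ r)
    (hk : (d - 1) * r + 1 ≤ k) (hn : k + 2 ≤ n) (x : ℕ) :
    ∃ F ∈ famM n k d r, x ∉ F := by
  set S := Finset.Icc 2 (2 + (d - 1) * r) with hS
  have hScard : S.card = (d - 1) * r + 1 := by rw [hS, Nat.card_Icc]; omega
  by_cases hx : x ∈ S
  · have hx2 := Finset.mem_Icc.1 hx
    have h1S : 1 ∉ S.erase x := by simp [hS]
    have hsub : insert 1 (S.erase x) ⊆ (Finset.Icc 1 n).erase x := by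
      intro y hy
      simp only [hS, Finset.mem_insert, Finset.mem_erase, Finset.mem_Icc] at hy ⊢
      omega
    have hxn : x ∈ Finset.Icc 1 n := Finset.mem_Icc.2 (by omega)
    obtain ⟨F, hSF, hFn, hFk⟩ := Finset.exists_subsuperset_card_eq (n := k) hsub
      (by rw [Finset.card_insert_of_notMem h1S, Finset.card_erase_of_mem hx]; omega)
      (by rw [Finset.card_erase_of_mem hxn, Nat.card_Icc]; omega)
    refine ⟨F, mem_famM.2 (Or.inl ⟨hFn.trans (Finset.erase_subset _ _), hFk,
      hSF (Finset.mem_insert_self _ _), ?_⟩), fun h => Finset.notMem_erase _ _ (hFn h)⟩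
    have hle : (S.erase x).card ≤ (F ∩ S).card := Finset.card_le_card <|
      Finset.subset_inter ((Finset.subset_insert _ _).trans hSF) (Finset.erase_subset _ _)
    rw [Finset.card_erase_of_mem hx, hScard] at hle
    have hmul : (d - 1) * r = (d - 2) * r + r := by
      rw [← Nat.succ_mul]
      congr 1
      omega
    rw [← hS]
    omega
  · have hsub : S ⊆ (Finset.Icc 2 n).erase x := fun y hy => by
      have hyx : y ≠ x := fun h => hx (h ▸ hy)
      simp only [hS, Finset.mem_erase, Finset.mem_Icc] at hy ⊢
      omega
    obtain ⟨F, hSF, hFn, hFk⟩ := Finset.exists_subsuperset_card_eq (n := k) hsub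
      (by omega)
      (by
        have := Finset.pred_card_le_card_erase (s := Finset.Icc 2 n) (a := x)
        rw [Nat.card_Icc] at this
        omega)
    exact ⟨F, mem_famM.2 (Or.inr ⟨hFn.trans (Finset.erase_subset _ _), hFk, hSF⟩),
      fun h => Finset.notMem_erase _ _ (hFn h)⟩

theorem card_sdiff_le_of_mem_famM {n k d r : ℕ} (hd : 2 ≤ d) {F : Finset ℕ}
    (hF : F ∈ famM n k d r) : (Finset.Icc 2 (2 + (d - 1) * r) \ F).card ≤ r := by
  rcases mem_famM.1 hF with ⟨-, -, -, h⟩ | ⟨-, -, h⟩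
  · have hmul : (d - 1) * r = (d - 2) * r + r := by
      rw [← Nat.succ_mul]
      congr 1
      omega
    rw [Finset.card_sdiff, Nat.card_Icc]
    omega
  · simp [Finset.sdiff_eq_empty_iff_subset.2 h]

theorem famM_wise_intersecting {n k d r : ℕ} (hd : 2 ≤ d) (G : Fin d → Finset ℕ)
    (hG : ∀ i, G i ∈ famM n k d r) : (⋂ i, (G i : Set ℕ)).Nonempty := by
  by_cases h1 : ∀ i, 1 ∈ G i
  · exact ⟨1, Set.mem_iInter.2 h1⟩
  push Not at h1
  obtain ⟨j, hj⟩ := h1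
  have hSj : Finset.Icc 2 (2 + (d - 1) * r) ⊆ G j := by
    rcases mem_famM.1 (hG j) with ⟨-, -, h, -⟩ | ⟨-, -, h⟩
    · exact absurd h hj
    · exact h
  set S := Finset.Icc 2 (2 + (d - 1) * r) with hS
  have hcard : ((Finset.univ.erase j).biUnion fun i => S \ G i).card < S.card := by
    calc _ ≤ (Finset.univ.erase j).card * r :=
          Finset.card_biUnion_le_card_mul _ _ _ fun i _ => card_sdiff_le_of_mem_famM hd (hG i)
      _ = (d - 1) * r := by simp [Finset.card_erase_of_mem]
      _ < S.card := by rw [hS, Nat.card_Icc]; omega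
  obtain ⟨x, hxS, hx⟩ := Finset.exists_mem_notMem_of_card_lt_card hcard
  refine ⟨x, Set.mem_iInter.2 fun i => ?_⟩
  by_cases hij : i = j
  · exact hij ▸ hSj hxS
  · by_contra hxi
    exact hx (Finset.mem_biUnion.2
      ⟨i, Finset.mem_erase.2 ⟨hij, Finset.mem_univ i⟩, Finset.mem_sdiff.2 ⟨hxS, hxi⟩⟩)

/-- For `d ≥ 2`, `1 ≤ r ≤ ⌊(k-1)/(d-1)⌋` and `n ≥ k+2`, the family `M(n,k,d,r)` is a
nonempty nontrivial `d`-wise intersecting family of `k`-subsets of `[n]`. -/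
theorem stmt_13 (n k d r : ℕ) (hd : 2 ≤ d) (hr1 : 1 ≤ r) (hr2 : r ≤ (k - 1) / (d - 1))
    (hn : k + 2 ≤ n) :
    (∀ F ∈ famM n k d r, F ⊆ Finset.Icc 1 n ∧ F.card = k) ∧
    (famM n k d r).Nonempty ∧
    (∀ G : Fin d → Finset ℕ, (∀ i, G i ∈ famM n k d r) → (⋂ i, (G i : Set ℕ)).Nonempty) ∧
    (⋂ F ∈ ((famM n k d r : Finset (Finset ℕ)) : Set (Finset ℕ)), (F : Set ℕ)) = ∅ := by
  have hdr : (d - 1) * r ≤ k - 1 := by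
    rw [mul_comm]
    exact (Nat.le_div_iff_mul_le (by omega)).1 hr2
  have hpos : 0 < (d - 1) * r := Nat.mul_pos (by omega) hr1
  have havoid := exists_mem_famM_notMem (n := n) (k := k) hd hr1 (by omega) hn
  refine ⟨fun F hF => famM_subset_and_card hF, ?_, famM_wise_intersecting hd, ?_⟩
  · obtain ⟨F, hF, -⟩ := havoid 0
    exact ⟨F, hF⟩
  · refine Set.eq_empty_of_forall_notMem fun x hx => ?_
    obtain ⟨F, hF, hxF⟩ := havoid x
    exact hxF (Set.mem_iInter₂.1 hx F hF)
end

section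
/- Let n, k, d be integers with 2 ≤ d < k and k+1 ≤ n ≤ d(k-d+2). Then |A(n,k,d)| ≥ |H(n,k,d)|. -/
open Finset

theorem choose_succ_add_le (r t e : ℕ) (ht : 1 ≤ t) (h : r ≤ e * (t + 1)) :
    (r + t).choose (t + 1) + e ≤ e * (r + t).choose t + r.choose (t + 1) := by
  rcases Nat.eq_zero_or_pos r with rfl | hr
  · simp
  have key : (r + t).choose (t + 1) * (t + 1) = (r + t).choose t * r := by
    have := Nat.choose_succ_right_eq (r + t) t
    rwa [Nat.add_sub_cancel] at this
  obtain ⟨s, hs⟩ := Nat.exists_eq_add_of_le h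
  have main : r + s ≤ s * (r + t).choose t + (t + 1) * r.choose (t + 1) := by
    rcases Nat.eq_zero_or_pos s with rfl | hs0
    · obtain ⟨q, rfl⟩ : ∃ q, r = q + 1 := ⟨r - 1, by omega⟩
      have he : 1 ≤ e := by
        rcases Nat.eq_zero_or_pos e with rfl | he
        · omega
        · exact he
      have hq : t ≤ q := by nlinarith
      have h1 := Nat.add_one_mul_choose_eq q t
      have h2 := Nat.choose_pos hq
      nlinarith
    · have hX : r + 1 ≤ (r + t).choose t := by
        calc r + 1 = (r + 1).choose r := by simp
          _ ≤ (r + t).choose r := Nat.choose_le_choose r (by omega)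
          _ = (r + t).choose t := Nat.choose_symm_add
      nlinarith
  have : ((r + t).choose (t + 1) + e) * (t + 1) ≤
      (e * (r + t).choose t + r.choose (t + 1)) * (t + 1) := by
    have h3 : e * (r + t).choose t * (t + 1) = (r + s) * (r + t).choose t := by
      rw [← hs]; ring
    nlinarith
  exact Nat.le_of_mul_le_mul_right this (Nat.succ_pos t)

theorem card_famH_le (n k d : ℕ) (hd : 1 ≤ d) (hdk : d ≤ k) (hn : k + 1 ≤ n) :
    (famH n k d).card + (n - k - 1).choose (k - d + 1) ≤
      (n + 1 - d).choose (k - d + 1) + (d - 1) := by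
  set F := ((Icc 1 n).powersetCard k).filter
    (fun A => Icc 1 (d - 1) ⊆ A ∧ (A ∩ Icc d (k + 1)).Nonempty) with hF
  set P := powersetCard (k - d + 1) (Icc d n)
  set Q := powersetCard (k - d + 1) (Icc (k + 2) n)
  have hQP : Q ⊆ P := powersetCard_mono (Icc_subset_Icc (by omega) le_rfl)
  have hP : P.card = (n + 1 - d).choose (k - d + 1) := by
    simp [P, card_powersetCard]
  have hQ : Q.card = (n - k - 1).choose (k - d + 1) := by
    simp only [Q, card_powersetCard, Nat.card_Icc]
    congr 1
    omega
  have hFle : F.card ≤ (P \ Q).card := by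
    refine card_le_card_of_injOn (fun A => A \ Icc 1 (d - 1)) ?_ ?_
    · intro A hA
      simp only [hF, coe_filter, mem_powersetCard, Set.mem_ofPred_eq] at hA
      obtain ⟨⟨hAn, hAk⟩, hsub, x, hx⟩ := hA
      simp only [mem_inter, mem_Icc] at hx
      simp only [P, Q, coe_sdiff, Set.mem_sdiff, mem_coe, mem_powersetCard, not_and]
      refine ⟨⟨?_, ?_⟩, ?_⟩
      · intro y hy
        simp only [mem_sdiff, mem_Icc] at hy
        have := mem_Icc.1 (hAn hy.1)
        simp only [mem_Icc]
        omega
      · rw [card_sdiff_of_subset hsub, hAk, Nat.card_Icc]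
        omega
      · intro hc
        have hmem : x ∈ A \ Icc 1 (d - 1) := by
          simp only [mem_sdiff, mem_Icc]
          exact ⟨hx.1, by omega⟩
        have := mem_Icc.1 (hc hmem)
        omega
    · intro A hA B hB hAB
      simp only [hF, coe_filter, Set.mem_ofPred_eq] at hA hB
      rw [← sdiff_union_of_subset hA.2.1, ← sdiff_union_of_subset hB.2.1]
      exact congrArg (· ∪ Icc 1 (d - 1)) hAB
  have hI : ((Icc 1 (d - 1)).image (fun i => Icc 1 (k + 1) \ {i})).card ≤ d - 1 :=
    card_image_le.trans (by simp)
  have hU : (famH n k d).card ≤ F.card +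
      ((Icc 1 (d - 1)).image (fun i => Icc 1 (k + 1) \ {i})).card := card_union_le _ _
  have hPQ := card_sdiff_add_card_eq_card hQP
  omega

theorem le_card_famA (n k d : ℕ) (hdk : d < k) (hn : d + 1 ≤ n) :
    (d + 1) * (n - d - 1).choose (k - d) + (n - d - 1).choose (k - d - 1) ≤
      (famA n k d).card := by
  set S := Icc 1 (d + 1) with hS
  set B := Icc (d + 2) n with hB
  have hSB : Disjoint S B := by
    rw [disjoint_left]
    intro x hx hy
    simp only [hS, hB, mem_Icc] at hx hy
    omega
  have hSn : S ⊆ Icc 1 n := Icc_subset_Icc le_rfl hn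
  have hBn : B ⊆ Icc 1 n := Icc_subset_Icc (by omega) le_rfl
  have hSc : S.card = d + 1 := by simp [hS]
  have hBc : B.card = n - d - 1 := by simp only [hB, Nat.card_Icc]; omega
  have hcapS {x y : Finset ℕ} (hx : x ⊆ S) (hy : y ⊆ B) : (x ∪ y) ∩ S = x := by
    rw [union_inter_distrib_right, inter_eq_left.2 hx,
      disjoint_iff_inter_eq_empty.1 (hSB.symm.mono_left hy), union_empty]
  have hcapB {x y : Finset ℕ} (hx : x ⊆ S) (hy : y ⊆ B) : (x ∪ y) ∩ B = y := by
    rw [union_inter_distrib_right, inter_eq_left.2 hy,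
      disjoint_iff_inter_eq_empty.1 (hSB.mono_left hx), empty_union]
  set T := powersetCard d S ×ˢ powersetCard (k - d) B ∪
    powersetCard (d + 1) S ×ˢ powersetCard (k - d - 1) B with hT
  have hTc : T.card =
      (d + 1) * (n - d - 1).choose (k - d) + (n - d - 1).choose (k - d - 1) := by
    rw [hT, card_union_of_disjoint]
    · simp [card_product, card_powersetCard, hSc, hBc]
    · rw [disjoint_left]
      rintro ⟨x, y⟩ h1 h2
      simp only [mem_product, mem_powersetCard] at h1 h2
      omega
  have hmem {x y : Finset ℕ} (h : (x, y) ∈ T) :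
      x ⊆ S ∧ y ⊆ B ∧ d ≤ x.card ∧ x.card + y.card = k := by
    simp only [hT, mem_union, mem_product, mem_powersetCard] at h
    rcases h with ⟨⟨h1, h2⟩, h3, h4⟩ | ⟨⟨h1, h2⟩, h3, h4⟩ <;>
      exact ⟨h1, h3, by omega, by omega⟩
  rw [← hTc]
  refine card_le_card_of_injOn (fun p => p.1 ∪ p.2) ?_ ?_
  · rintro ⟨x, y⟩ hxy
    obtain ⟨hx, hy, hd, hk⟩ := hmem hxy
    simp only [famA, coe_filter, Set.mem_ofPred_eq, mem_powersetCard]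
    refine ⟨⟨union_subset (hx.trans hSn) (hy.trans hBn), ?_⟩, ?_⟩
    · rw [card_union_of_disjoint (hSB.mono hx hy), hk]
    · rw [← hS, hcapS hx hy]
      exact hd
  · rintro ⟨x, y⟩ hxy ⟨x', y'⟩ hxy' h
    obtain ⟨hx, hy, -⟩ := hmem hxy
    obtain ⟨hx', hy', -⟩ := hmem hxy'
    replace h : x ∪ y = x' ∪ y' := h
    rw [Prod.mk.injEq]
    constructor
    · rw [← hcapS hx hy, h, hcapS hx' hy']
    · rw [← hcapB hx hy, h, hcapB hx' hy']

/-- For `2 ≤ d < k` and `k+1 ≤ n ≤ d(k-d+2)`, we have `|A(n,k,d)| ≥ |H(n,k,d)|`. -/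
theorem stmt_14 (n k d : ℕ) (hd : 2 ≤ d) (hdk : d < k) (hn1 : k + 1 ≤ n)
    (hn2 : n ≤ d * (k - d + 2)) :
    (famH n k d).card ≤ (famA n k d).card := by
  have hH := card_famH_le n k d (by omega) hdk.le hn1
  have hA := le_card_famA n k d hdk (by omega)
  obtain ⟨t, rfl⟩ : ∃ t, k = d + (t + 1) := ⟨k - d - 1, by omega⟩
  obtain ⟨r, rfl⟩ : ∃ r, n = d + (t + 1) + 1 + r := ⟨n - (d + (t + 1) + 1), by omega⟩
  obtain ⟨e, rfl⟩ : ∃ e, d = e + 1 := ⟨d - 1, by omega⟩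
  have e1 : e + 1 + (t + 1) - (e + 1) = t + 1 := by omega
  have e2 : e + 1 + (t + 1) + 1 + r - (e + 1 + (t + 1)) - 1 = r := by omega
  have e3 : e + 1 + (t + 1) + 1 + r + 1 - (e + 1) = r + (t + 1) + 1 + 1 := by omega
  have e4 : e + 1 + (t + 1) + 1 + r - (e + 1) - 1 = r + (t + 1) := by omega
  rw [e1] at hn2
  rw [e1, e2, e3, Nat.add_sub_cancel] at hH
  rw [e1, e4, Nat.add_sub_cancel] at hA
  have key := choose_succ_add_le r (t + 1) e (by omega) (by nlinarith)
  have p1 := Nat.choose_succ_succ' (r + (t + 1) + 1) (t + 1)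
  have p2 := Nat.choose_succ_succ' (r + (t + 1)) (t + 1)
  have p3 := Nat.choose_succ_succ' (r + (t + 1)) t
  nlinarith
end

section
/- Let n, k, d be integers with d ≥ 2, k ≥ d, n ≥ k+1, and suppose d-1 divides k-1. Then M(n,k,d,(k-1)/(d-1)) = T(n,k,d,1), i.e. these two families of k-element subsets of [n] are equal. -/
/-- `famT n k d r` is the family
`T(n,k,d,r) = {A ⊆ [n] : |A| = k, [r] ⊆ A, |A ∩ [r+1, k+1]| ≥ j₀} ∪ {[k+1]∖{i} : i ∈ [r]}`,
where `j₀ = ⌊((d-r-1)/(d-r))·(k-r+1)⌋ + 1`. -/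
def famT (n k d r : ℕ) : Finset (Finset ℕ) :=
  ((Finset.Icc 1 n).powersetCard k).filter
    (fun A => Finset.Icc 1 r ⊆ A ∧
      (d - r - 1) * (k - r + 1) / (d - r) + 1 ≤ (A ∩ Finset.Icc (r + 1) (k + 1)).card)
    ∪ (Finset.Icc 1 r).image (fun i => Finset.Icc 1 (k + 1) \ {i})

/-- If `d ≥ 2`, `k ≥ d`, `n ≥ k+1` and `d-1` divides `k-1`, then
`M(n,k,d,(k-1)/(d-1)) = T(n,k,d,1)`. -/
theorem stmt_16 (n k d : ℕ) (hd : 2 ≤ d) (hk : d ≤ k) (hn : k + 1 ≤ n)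
    (hdvd : (d - 1) ∣ (k - 1)) :
    famM n k d ((k - 1) / (d - 1)) = famT n k d 1 := by
  obtain ⟨e, rfl⟩ : ∃ e, d = e + 2 := ⟨d - 2, by omega⟩
  obtain ⟨q, hq⟩ := hdvd
  obtain rfl : k = (e + 1) * q + 1 := by
    rw [show e + 2 - 1 = e + 1 by omega] at hq
    omega
  have hr : ((e + 1) * q + 1 - 1) / (e + 2 - 1) = q :=
    Nat.mul_div_cancel_left q e.succ_pos
  have htop : 2 + (e + 2 - 1) * q = (e + 1) * q + 1 + 1 := by
    rw [show e + 2 - 1 = e + 1 by omega]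
    ring
  have hj : (e + 2 - 1 - 1) * ((e + 1) * q + 1 - 1 + 1) / (e + 2 - 1) = e * q := by
    have h : e * ((e + 1) * q + 1) = e + (e + 1) * (e * q) := by ring
    simp [h, Nat.add_mul_div_left]
  unfold famM famT
  rw [hr, htop, hj]
  congr 1
  · refine Finset.filter_congr fun F _ => ?_
    simp [add_comm]
  · ext F
    simp only [Finset.mem_filter, Finset.mem_powersetCard, Finset.Icc_self,
      Finset.image_singleton, Finset.mem_singleton]
    have hI : Finset.Icc 1 ((e + 1) * q + 1 + 1) \ {1} =
        Finset.Icc 2 ((e + 1) * q + 1 + 1) := by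
      ext x
      simp only [Finset.mem_sdiff, Finset.mem_Icc, Finset.mem_singleton]
      omega
    rw [hI]
    constructor
    · rintro ⟨⟨-, hcard⟩, hsub⟩
      exact (Finset.eq_of_subset_of_card_le hsub (by simp [hcard])).symm
    · rintro rfl
      exact ⟨⟨Finset.Icc_subset_Icc_right hn, by simp⟩, subset_rfl⟩
end

section
/- For n = 12, k = 8, d = 3: |M(12,8,3,3)| = 299 and max_{0 ≤ r ≤ 2} |T(12,8,3,r)| = 261; in particular |M(12,8,3,3)| > max_{0 ≤ r ≤ 2} |T(12,8,3,r)|. -/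
open Finset in
/-- The number of `k`-subsets of `U` that contain `C` and meet `A` in at least `m` points,
where `C` and `A` are disjoint subsets of `U`. -/
theorem card_filter_subset_le_card_inter {α : Type*} [DecidableEq α] {U C A : Finset α}
    (hC : C ⊆ U) (hA : A ⊆ U) (hCA : Disjoint C A) {k : ℕ} (hk : #C ≤ k) (m : ℕ) :
    #{F ∈ U.powersetCard k | C ⊆ F ∧ m ≤ #(F ∩ A)} =
      ∑ j ∈ Icc m (k - #C), (#A).choose j * (#U - #C - #A).choose (k - #C - j) := by
  have hinter : ∀ P ⊆ A, ∀ Q ⊆ U \ (C ∪ A), (C ∪ P ∪ Q) ∩ A = P := fun P hP Q hQ ↦ by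
    ext x
    have h₁ := @hP x
    have h₂ := @hQ x
    have h₃ : x ∈ C → x ∉ A := fun hx ↦ disjoint_left.1 hCA hx
    simp only [mem_inter, mem_union, mem_sdiff] at h₂ ⊢
    tauto
  have hsdiff : ∀ P ⊆ A, ∀ Q ⊆ U \ (C ∪ A), (C ∪ P ∪ Q) \ (C ∪ A) = Q := fun P hP Q hQ ↦ by
    ext x
    have h₁ := @hP x
    have h₂ := @hQ x
    simp only [mem_union, mem_sdiff] at h₂ ⊢
    tauto
  have hU : #(U \ (C ∪ A)) = #U - #C - #A := by
    rw [card_sdiff_of_subset (union_subset hC hA), card_union_of_disjoint hCA, Nat.sub_add_eq]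
  have hF : ∀ F, C ⊆ F → #C + #(F ∩ A) + #(F \ (C ∪ A)) = #F := fun F hCF ↦ by
    rw [← card_union_of_disjoint (hCA.mono_right inter_subset_right), ← card_union_of_disjoint]
    · congr 1
      grind
    · rw [disjoint_left]
      grind
  have hsigma : #((Icc m (k - #C)).sigma fun j ↦
      A.powersetCard j ×ˢ (U \ (C ∪ A)).powersetCard (k - #C - j)) =
      ∑ j ∈ Icc m (k - #C), (#A).choose j * (#U - #C - #A).choose (k - #C - j) := by
    simp only [card_sigma, card_product, card_powersetCard, hU]
  rw [← hsigma]
  refine card_nbij' (fun F ↦ ⟨#(F ∩ A), F ∩ A, F \ (C ∪ A)⟩) (fun x ↦ C ∪ x.2.1 ∪ x.2.2)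
    ?_ ?_ ?_ ?_
  · intro F h
    simp only [coe_filter, mem_powersetCard, Set.mem_ofPred_eq] at h
    have := hF F h.2.1
    simp only [coe_sigma, Set.mem_sigma_iff, mem_coe, mem_Icc, mem_product, mem_powersetCard]
    exact ⟨⟨h.2.2, by lia⟩, ⟨inter_subset_right, trivial⟩, sdiff_subset_sdiff h.1.1 subset_rfl, by lia⟩
  · rintro ⟨j, P, Q⟩ h
    simp only [coe_sigma, Set.mem_sigma_iff, mem_coe, mem_Icc, mem_product, mem_powersetCard] at h
    obtain ⟨⟨hm, hj⟩, ⟨hP, hPj⟩, hQ, hQj⟩ := h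
    have hCF : C ⊆ C ∪ P ∪ Q := subset_union_left.trans subset_union_left
    have := hF (C ∪ P ∪ Q) hCF
    rw [hinter P hP Q hQ, hsdiff P hP Q hQ] at this
    simp only [coe_filter, mem_powersetCard, Set.mem_ofPred_eq, hinter P hP Q hQ]
    exact ⟨⟨union_subset (union_subset hC (hP.trans hA)) (hQ.trans sdiff_subset), by lia⟩, hCF,
      by lia⟩
  · intro F h
    simp only [coe_filter, mem_powersetCard, Set.mem_ofPred_eq] at h
    ext x
    have := @h.2.1 x
    simp only [mem_union, mem_inter, mem_sdiff]
    tauto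
  · rintro ⟨j, P, Q⟩ h
    simp only [coe_sigma, Set.mem_sigma_iff, mem_coe, mem_Icc, mem_product, mem_powersetCard] at h
    obtain ⟨-, ⟨hP, hPj⟩, hQ, -⟩ := h
    simp only [hinter P hP Q hQ, hsdiff P hP Q hQ, hPj]

open Finset in
theorem card_famM {n k d r : ℕ} (hk : 1 ≤ k) (hrk : (d - 1) * r + 1 ≤ k)
    (hrn : 2 + (d - 1) * r ≤ n) :
    #(famM n k d r) =
      ∑ j ∈ Icc (1 + (d - 2) * r) (k - 1),
        ((d - 1) * r + 1).choose j * (n - 1 - ((d - 1) * r + 1)).choose (k - 1 - j) +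
      (n - 1 - ((d - 1) * r + 1)).choose (k - ((d - 1) * r + 1)) := by
  have hI : #(Icc 2 (2 + (d - 1) * r)) = (d - 1) * r + 1 := by
    rw [Nat.card_Icc]
    lia
  rw [famM, card_union_of_disjoint]
  · congr 1
    · have := card_filter_subset_le_card_inter (U := Icc 1 n) (C := {1})
        (A := Icc 2 (2 + (d - 1) * r)) (by grind) (by grind) (by simp)
        (by simpa using hk) (1 + (d - 2) * r)
      simpa only [singleton_subset_iff, card_singleton, hI, Nat.card_Icc,
        Nat.add_sub_cancel] using this
    · have := card_filter_subset_le_card_inter (U := Icc 2 n) (C := Icc 2 (2 + (d - 1) * r))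
        (A := ∅) (by grind) (by simp) (by simp) (hI.trans_le hrk) 0
      have hn : n + 1 - 2 = n - 1 := by lia
      simp only [hI, Nat.card_Icc, hn, inter_empty, card_empty, le_refl, and_true,
        Nat.sub_zero] at this
      rw [this, sum_eq_single_of_mem 0 (by simp)]
      · simp
      · intro j _ hj
        simp [Nat.choose_eq_zero_of_lt (Nat.pos_of_ne_zero hj)]
  · rw [disjoint_left]
    intro F hF hF'
    have := (mem_powersetCard.1 (mem_filter.1 hF').1).1 (mem_filter.1 hF).2.1
    simp at this

open Finset in
theorem card_famT {n k d r : ℕ} (hrk : r ≤ k) (hkn : k + 1 ≤ n) :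
    #(famT n k d r) =
      ∑ j ∈ Icc ((d - r - 1) * (k - r + 1) / (d - r) + 1) (k - r),
        (k + 1 - r).choose j * (n - r - (k + 1 - r)).choose (k - r - j) + r := by
  rw [famT, card_union_of_disjoint]
  · congr 1
    · have := card_filter_subset_le_card_inter (U := Icc 1 n) (C := Icc 1 r)
        (A := Icc (r + 1) (k + 1)) (by grind) (by grind)
        (by rw [disjoint_left]; grind) (k := k) (by simpa using hrk)
        ((d - r - 1) * (k - r + 1) / (d - r) + 1)
      have hA : k + 1 + 1 - (r + 1) = k + 1 - r := by lia
      simpa only [Nat.card_Icc, Nat.add_sub_cancel, hA] using this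
    · rw [card_image_of_injOn, Nat.card_Icc, Nat.add_sub_cancel]
      intro i hi j hj hij
      have hi' : i ∈ Icc 1 (k + 1) := by grind
      by_contra hne
      have : i ∈ Icc 1 (k + 1) \ {j} := by grind
      simp [← show Icc 1 (k + 1) \ {i} = Icc 1 (k + 1) \ {j} from hij] at this
  · rw [disjoint_left]
    intro F hF hF'
    obtain ⟨i, hi, rfl⟩ := mem_image.1 hF'
    have := (mem_filter.1 hF).2.1 hi
    simp at this

/-- `|M(12,8,3,3)| = 299`, `max_{0 ≤ r ≤ 2} |T(12,8,3,r)| = 261`, and in particular the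
former exceeds the latter. -/
theorem stmt_17 :
    (famM 12 8 3 3).card = 299 ∧
    ((Finset.range 3).sup fun r => (famT 12 8 3 r).card) = 261 ∧
    ((Finset.range 3).sup fun r => (famT 12 8 3 r).card) < (famM 12 8 3 3).card := by
  have hM : (famM 12 8 3 3).card = 299 := by
    rw [card_famM (by lia) (by lia) (by lia)]
    decide
  have hT : ((Finset.range 3).sup fun r => (famT 12 8 3 r).card) = 261 := by
    have h0 : (famT 12 8 3 0).card = 117 := by
      rw [card_famT (by lia) (by lia)]
      decide
    have h1 : (famT 12 8 3 1).card = 261 := by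
      rw [card_famT (by lia) (by lia)]
      decide
    have h2 : (famT 12 8 3 2).card = 212 := by
      rw [card_famT (by lia) (by lia)]
      decide
    simp [Finset.range_add_one, h0, h1, h2]
  exact ⟨hM, hT, by rw [hM, hT]; lia⟩
end

section
/- Let s, t ≥ 1 and n ≥ 3s + t be integers. Let S = {1,…,s} and R = {s+1,…,s+t+2s} be disjoint sets of vertices of [n], and let 𝓕 be the family of all labelled graphs G on [n] such that every vertex of S has at least t+2s-1 neighbors in R in G. Then 𝓕 is K_{s,t}-intersecting, and |𝓕| = (t+2s+1)^s · 2^{C(n,2) - st - 2s²}. -/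
open scoped Classical in
/-- The potential edges on `V` that do not join a vertex of `A` to a vertex of `B`. -/
noncomputable def edgesOutside {V : Type*} [Fintype V] (A B : Finset V) : Finset (Sym2 V) :=
  Finset.univ.filter (fun e : Sym2 V => ¬ e.IsDiag) \ (A ×ˢ B).image (fun p => s(p.1, p.2))

lemma mk_mem_edgesOutside {V : Type*} [Fintype V] {A B : Finset V} {u v : V} :
    s(u, v) ∈ edgesOutside A B ↔ u ≠ v ∧ ¬ (u ∈ A ∧ v ∈ B) ∧ ¬ (v ∈ A ∧ u ∈ B) := by
  simp only [edgesOutside, Finset.mem_sdiff, Finset.mem_filter, Finset.mem_univ, true_and,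
    Sym2.mk_isDiag_iff, Finset.mem_image, Finset.mem_product, Prod.exists, Sym2.eq_iff]
  constructor
  · rintro ⟨h, h'⟩
    exact ⟨h, fun hh => h' ⟨u, v, hh, .inl ⟨rfl, rfl⟩⟩, fun hh => h' ⟨v, u, hh, .inr ⟨rfl, rfl⟩⟩⟩
  · rintro ⟨h, h₁, h₂⟩
    refine ⟨h, ?_⟩
    rintro ⟨a, b, hab, ⟨rfl, rfl⟩ | ⟨rfl, rfl⟩⟩
    exacts [h₁ hab, h₂ hab]

lemma card_edgesOutside {V : Type*} [Fintype V] {A B : Finset V} (hAB : Disjoint A B) :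
    (edgesOutside A B).card = (Fintype.card V).choose 2 - A.card * B.card := by
  classical
  have hne : ∀ {a b}, a ∈ A → b ∈ B → a ≠ b := fun ha hb h =>
    Finset.disjoint_left.1 hAB ha (h ▸ hb)
  rw [edgesOutside, Finset.card_sdiff_of_subset]
  · congr 1
    · rw [← Sym2.card_subtype_not_diag, Fintype.card_subtype]
    · rw [Finset.card_image_of_injOn, Finset.card_product]
      rintro ⟨a, b⟩ h ⟨c, d⟩ h' he
      simp only [Finset.coe_product, Set.mem_prod, Finset.mem_coe] at h h'
      rcases Sym2.eq_iff.1 he with ⟨h₁, h₂⟩ | ⟨h₁, -⟩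
      · exact Prod.ext h₁ h₂
      · exact absurd h₁ (hne h.1 h'.2)
  · intro e he
    obtain ⟨⟨a, b⟩, hp, rfl⟩ := Finset.mem_image.1 he
    have hp := Finset.mem_product.1 hp
    simpa using hne hp.1 hp.2

open scoped Classical in
/-- The number of graphs in which every vertex of `A` has at least `k` neighbors in the
disjoint set `B`. -/
lemma card_of_forall_mem_iff_le_card_neighbors {V : Type*} [Fintype V] {A B : Finset V}
    (hAB : Disjoint A B) (k : ℕ) {𝓕 : Finset (SimpleGraph V)}
    (h𝓕 : ∀ G, G ∈ 𝓕 ↔ ∀ a ∈ A, k ≤ (B.filter (fun b => G.Adj a b)).card) :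
    𝓕.card =
    (B.powerset.filter (fun T => k ≤ T.card)).card ^ A.card *
      2 ^ ((Fintype.card V).choose 2 - A.card * B.card) := by
  have hA : ∀ {a}, a ∈ A → a ∉ B := fun ha hb => Finset.disjoint_left.1 hAB ha hb
  have hcard : (B.powerset.filter (fun T => k ≤ T.card)).card ^ A.card *
      2 ^ ((Fintype.card V).choose 2 - A.card * B.card) =
      (Fintype.piFinset (fun _ : A => B.powerset.filter (fun T => k ≤ T.card)) ×ˢ
        (edgesOutside A B).powerset).card := by
    simp [Finset.card_product, card_edgesOutside hAB, Fintype.card_piFinset]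
  rw [hcard]
  refine Finset.card_nbij'
    (fun G => (fun a => B.filter (fun b => G.Adj a b),
      (edgesOutside A B).filter (fun e => e ∈ G.edgeSet)))
    (fun p => SimpleGraph.fromRel (fun u v => (∃ h : u ∈ A, v ∈ p.1 ⟨u, h⟩) ∨ s(u, v) ∈ p.2))
    ?_ ?_ ?_ ?_
  · intro G hG
    rw [Finset.mem_coe, h𝓕] at hG
    simp only [Finset.coe_product, Set.mem_prod, Finset.mem_coe, Fintype.mem_piFinset,
      Finset.mem_filter, Finset.mem_powerset, Finset.filter_subset, true_and, and_true]
    exact fun a => hG a a.2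
  · rintro ⟨f, X⟩ h
    simp only [Finset.coe_product, Set.mem_prod, Finset.mem_coe, Fintype.mem_piFinset,
      Finset.mem_filter, Finset.mem_powerset] at h
    rw [Finset.mem_coe, h𝓕]
    intro a ha
    refine (h.1 ⟨a, ha⟩).2.trans (Finset.card_le_card fun b hb => ?_)
    have hbB := (h.1 ⟨a, ha⟩).1 hb
    simp only [Finset.mem_filter, SimpleGraph.fromRel_adj]
    exact ⟨hbB, fun hab => hA ha (hab ▸ hbB), .inl (.inl ⟨ha, hb⟩)⟩
  · intro G _
    ext u v
    simp only [SimpleGraph.fromRel_adj, Finset.mem_filter, mk_mem_edgesOutside,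
      SimpleGraph.mem_edgeSet, G.adj_comm v u]
    constructor
    · rintro ⟨-, (⟨-, -, h⟩ | ⟨-, h⟩) | (⟨-, -, h⟩ | ⟨-, h⟩)⟩
      exacts [h, h, h, h]
    · intro h
      have := h.ne
      have := h.symm
      grind
  · rintro ⟨f, X⟩ h
    simp only [Finset.coe_product, Set.mem_prod, Finset.mem_coe, Fintype.mem_piFinset,
      Finset.mem_filter, Finset.mem_powerset] at h
    obtain ⟨hf, hX⟩ := h
    refine Prod.ext (funext fun a => Finset.ext fun b => ?_) (Finset.ext fun e => ?_)
    · simp only [Finset.mem_filter, SimpleGraph.fromRel_adj]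
      constructor
      · rintro ⟨hb, -, (⟨_, h⟩ | h) | (⟨h, _⟩ | h)⟩
        · exact h
        · exact absurd ⟨a.2, hb⟩ (mk_mem_edgesOutside.1 (hX h)).2.1
        · exact absurd hb (hA h)
        · exact absurd ⟨a.2, hb⟩ (mk_mem_edgesOutside.1 (hX h)).2.2
      · intro hb
        have hbB := (hf a).1 hb
        exact ⟨hbB, fun hab => hA a.2 (hab ▸ hbB), .inl (.inl ⟨a.2, hb⟩)⟩
    · induction e with | _ u v
      simp only [Finset.mem_filter, SimpleGraph.mem_edgeSet, SimpleGraph.fromRel_adj]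
      constructor
      · rintro ⟨he, -, (⟨h, h'⟩ | h) | (⟨h, h'⟩ | h)⟩
        · exact absurd ⟨h, (hf _).1 h'⟩ (mk_mem_edgesOutside.1 he).2.1
        · exact h
        · exact absurd ⟨h, (hf _).1 h'⟩ (mk_mem_edgesOutside.1 he).2.2
        · rwa [Sym2.eq_swap]
      · exact fun h => ⟨hX h, (mk_mem_edgesOutside.1 (hX h)).1, .inl (.inr h)⟩

lemma card_filter_powerset_pred_le_card {V : Type*} (B : Finset V) (hB : B.Nonempty) :
    (B.powerset.filter (fun T => B.card - 1 ≤ T.card)).card = B.card + 1 := by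
  classical
  have hpos := hB.card_pos
  have h : B.powerset.filter (fun T => B.card - 1 ≤ T.card) =
      Finset.powersetCard (B.card - 1) B ∪ Finset.powersetCard B.card B := by
    ext T
    simp only [Finset.mem_filter, Finset.mem_powerset, Finset.mem_union, Finset.mem_powersetCard,
      ← and_or_left]
    refine and_congr_right fun hT => ?_
    have := Finset.card_le_card hT
    omega
  rw [h, Finset.card_union_of_disjoint
    (Finset.pairwise_disjoint_powersetCard B (by omega)), Finset.card_powersetCard,
    Finset.card_powersetCard, Nat.choose_self, Nat.choose_symm hpos, Nat.choose_one_right]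

open scoped Classical in
/-- If in both graphs every vertex of `A` is adjacent to all but at most one vertex of `B`, then
at least `#B - 2 * #A` vertices are common neighbors of `A` in the intersection. -/
lemma exists_common_neighbors_inf {V : Type*} {A B : Finset V} {G₁ G₂ : SimpleGraph V}
    (h₁ : ∀ a ∈ A, B.card - 1 ≤ (B.filter (fun b => G₁.Adj a b)).card)
    (h₂ : ∀ a ∈ A, B.card - 1 ≤ (B.filter (fun b => G₂.Adj a b)).card) :
    ∃ C : Finset V, (∀ b ∈ C, ∀ a ∈ A, (G₁ ⊓ G₂).Adj a b) ∧ B.card ≤ C.card + A.card * 2 := by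
  refine ⟨B.filter (fun b => ∀ a ∈ A, (G₁ ⊓ G₂).Adj a b),
    fun b hb => (Finset.mem_filter.1 hb).2, ?_⟩
  have hsub : B.filter (fun b => ¬ ∀ a ∈ A, (G₁ ⊓ G₂).Adj a b) ⊆ A.biUnion (fun a =>
      B.filter (fun b => ¬ G₁.Adj a b) ∪ B.filter (fun b => ¬ G₂.Adj a b)) := by
    intro b
    simp only [Finset.mem_filter, Finset.mem_biUnion, Finset.mem_union, SimpleGraph.inf_adj]
    grind
  have hbound := (Finset.card_le_card hsub).trans (Finset.card_biUnion_le_card_mul A _ 2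
    fun a ha => (Finset.card_union_le _ _).trans (by
      have := B.card_filter_add_card_filter_not (fun b => G₁.Adj a b)
      have := B.card_filter_add_card_filter_not (fun b => G₂.Adj a b)
      have := h₁ a ha
      have := h₂ a ha
      omega))
  have := B.card_filter_add_card_filter_not (fun b => ∀ a ∈ A, (G₁ ⊓ G₂).Adj a b)
  omega

open scoped Classical in
/-- For `s, t ≥ 1` and `n ≥ 3s + t`, let `S` be the first `s` vertices and `R` the next
`2s + t` vertices of `[n]`, and let `𝓕` be the family of all labelled graphs on `n`
vertices in which every vertex of `S` has at least `t + 2s - 1` neighbors in `R`. Then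
`𝓕` is `K_{s,t}`-intersecting and `|𝓕| = (t+2s+1)^s · 2^(C(n,2) - st - 2s²)`. -/
theorem stmt_19 (n s t : ℕ) (hs : 1 ≤ s) (ht : 1 ≤ t) (hn : 3 * s + t ≤ n)
    (𝓕 : Finset (SimpleGraph (Fin n)))
    (h𝓕 : 𝓕 = Finset.univ.filter (fun G : SimpleGraph (Fin n) =>
      ∀ v : Fin n, (v : ℕ) < s →
        t + 2 * s - 1 ≤ {u : Fin n | (s ≤ (u : ℕ) ∧ (u : ℕ) < 3 * s + t) ∧ G.Adj v u}.ncard)) :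
    (∀ G₁ ∈ 𝓕, ∀ G₂ ∈ 𝓕,
      ∃ f : Fin s ⊕ Fin t → Fin n, Function.Injective f ∧
        ∀ a b, (completeBipartiteGraph (Fin s) (Fin t)).Adj a b →
          (G₁ ⊓ G₂).Adj (f a) (f b)) ∧
    𝓕.card = (t + 2 * s + 1) ^ s * 2 ^ (n.choose 2 - s * t - 2 * s ^ 2) := by
  classical
  set A : Finset (Fin n) := Finset.univ.filter (fun v => (v : ℕ) < s) with hA
  set B : Finset (Fin n) := Finset.univ.filter (fun u => s ≤ (u : ℕ) ∧ (u : ℕ) < 3 * s + t) with hB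
  have hAcard : A.card = s := by
    rw [hA, Fin.card_filter_val_lt, min_eq_right (by omega)]
  have hBcard : B.card = t + 2 * s := by
    have : B.map Fin.valEmbedding = Finset.Ico s (3 * s + t) := by
      ext x
      simp only [hB, Finset.mem_map, Finset.mem_filter, Finset.mem_univ, true_and,
        Fin.valEmbedding_apply, Finset.mem_Ico]
      exact ⟨by rintro ⟨u, hu, rfl⟩; exact hu, fun hx => ⟨⟨x, by omega⟩, hx, rfl⟩⟩
    rw [← Finset.card_map Fin.valEmbedding, this, Nat.card_Ico]
    omega
  have hAB : Disjoint A B := by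
    rw [Finset.disjoint_left]
    intro v hv hv'
    simp only [hA, hB, Finset.mem_filter] at hv hv'
    omega
  have h𝓕' : 𝓕 = Finset.univ.filter (fun G : SimpleGraph (Fin n) =>
      ∀ a ∈ A, B.card - 1 ≤ (B.filter (fun b => G.Adj a b)).card) := by
    rw [h𝓕]
    ext G
    simp only [Finset.mem_filter, Finset.mem_univ, true_and, hBcard, hA]
    refine forall₂_congr fun v _ => ?_
    rw [← Set.ncard_coe_finset]
    simp [hB]
  constructor
  · intro G₁ h₁ G₂ h₂
    rw [h𝓕', Finset.mem_filter] at h₁ h₂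
    obtain ⟨C, hC, hCcard⟩ := exists_common_neighbors_inf h₁.2 h₂.2
    obtain ⟨g, hg⟩ : ∃ g : Fin t ↪ Fin n, ∀ j, g j ∈ C :=
      ⟨(Fin.castLEEmb (by omega)).trans (C.orderEmbOfFin rfl).toEmbedding,
        fun j => C.orderEmbOfFin_mem rfl _⟩
    have hmem : ∀ i : Fin s, Fin.castLE (by omega : s ≤ n) i ∈ A := fun i => by simp [hA]
    have hadj : ∀ i j, (G₁ ⊓ G₂).Adj (Fin.castLE (by omega : s ≤ n) i) (g j) := fun i j =>
      hC _ (hg j) _ (hmem i)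
    refine ⟨Sum.elim (Fin.castLE (by omega)) g,
      (Fin.castLE_injective _).sumElim g.injective fun i j => (hadj i j).ne, ?_⟩
    rintro (i | j) (i' | j') h
    · simp at h
    · exact hadj i j'
    · exact (hadj i' j).symm
    · simp at h
  · rw [card_of_forall_mem_iff_le_card_neighbors hAB (B.card - 1) fun G => by simp [h𝓕'],
      card_filter_powerset_pred_le_card B (Finset.card_pos.1 (by omega)), hAcard, hBcard,
      Fintype.card_fin, Nat.sub_sub]
    congr 3
    ring
end
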